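/- Let R̃ and R be p.m.p. countable Borel equivalence relations on standard probability spaces (X̃, μ̃) and (X, μ), and let p : X̃ → X be a locally bijective morphism from R̃ to R, i.e. a measurable map such that the pushforward p_*(μ̃) is equivalent to μ and, for almost every x̃ ∈ X̃, p restricts to a bijection from the R̃-class of x̃ onto the R-class of p(x̃). If R̃ is freely indecomposable, then R is freely indecomposable. -/

import Mathlib

open MeasureTheory

/-- A countable Borel equivalence relation on `X`, defined on a Borel domain `dom`:
it is Borel as a subset of `X × X`, is an equivalence relation on `dom`, and has
countable classes. -/
structure CBER (X : Type) [MeasurableSpace X] where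
  dom : Set X
  dom_meas : MeasurableSet dom
  rel : X → X → Prop
  rel_meas : MeasurableSet {p : X × X | rel p.1 p.2}
  rel_dom : ∀ {x y : X}, rel x y → x ∈ dom ∧ y ∈ dom
  refl : ∀ x ∈ dom, rel x x
  symm : ∀ {x y : X}, rel x y → rel y x
  trans : ∀ {x y z : X}, rel x y → rel y z → rel x z
  countable_classes : ∀ x : X, {y | rel x y}.Countable

/-- The class of `x`. -/
def CBER.cls {X : Type} [MeasurableSpace X] (R : CBER X) (x : X) : Set X := {y | R.rel x y}

/-- The `R`-saturation of a set `A`: the union of the `R`-classes meeting `A`. -/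
def CBER.sat {X : Type} [MeasurableSpace X] (R : CBER X) (A : Set X) : Set X :=
  {y | ∃ x ∈ A, R.rel x y}

/-- A complete section: a Borel subset of the domain meeting every class. -/
def CBER.IsCompleteSection {X : Type} [MeasurableSpace X] (R : CBER X) (A : Set X) : Prop :=
  MeasurableSet A ∧ A ⊆ R.dom ∧ ∀ x ∈ R.dom, ∃ y ∈ A, R.rel x y

/-- A smooth CBER: one admitting a Borel fundamental domain (a Borel set meeting
every class exactly once). -/
def CBER.Smooth {X : Type} [MeasurableSpace X] (R : CBER X) : Prop :=
  ∃ D : Set X, MeasurableSet D ∧ D ⊆ R.dom ∧ ∀ x ∈ R.dom, ∃! y, y ∈ D ∧ R.rel x y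

/-- Smoothness of the restriction `R|A`. -/
def CBER.SmoothOn {X : Type} [MeasurableSpace X] (R : CBER X) (A : Set X) : Prop :=
  ∃ D : Set X, MeasurableSet D ∧ D ⊆ A ∧ ∀ x ∈ R.dom ∩ A, ∃! y, y ∈ D ∧ R.rel x y

/-- All classes are finite. -/
def CBER.FiniteClasses {X : Type} [MeasurableSpace X] (R : CBER X) : Prop :=
  ∀ x ∈ R.dom, (R.cls x).Finite

/-- Aperiodic: all classes are infinite (on the domain). -/
def CBER.Aperiodic {X : Type} [MeasurableSpace X] (R : CBER X) : Prop :=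
  ∀ x ∈ R.dom, (R.cls x).Infinite

/-- Trivial: all classes are singletons. -/
def CBER.TrivialClasses {X : Type} [MeasurableSpace X] (R : CBER X) : Prop :=
  ∀ x y, R.rel x y → x = y

/-- The restriction `R|U` of `R` to a Borel set `U`. -/
def CBER.restrict {X : Type} [MeasurableSpace X] (R : CBER X) (U : Set X)
    (hU : MeasurableSet U) : CBER X where
  dom := R.dom ∩ U
  dom_meas := R.dom_meas.inter hU
  rel x y := R.rel x y ∧ x ∈ U ∧ y ∈ U
  rel_meas := by
    have h : {p : X × X | R.rel p.1 p.2 ∧ p.1 ∈ U ∧ p.2 ∈ U} =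
        {p : X × X | R.rel p.1 p.2} ∩ (Prod.fst ⁻¹' U ∩ Prod.snd ⁻¹' U) := by
      ext p
      simp only [Set.mem_setOf_eq, Set.mem_inter_iff, Set.mem_preimage, and_assoc]
    rw [h]
    exact R.rel_meas.inter ((measurable_fst hU).inter (measurable_snd hU))
  rel_dom := fun h => ⟨⟨(R.rel_dom h.1).1, h.2.1⟩, ⟨(R.rel_dom h.1).2, h.2.2⟩⟩
  refl := fun x hx => ⟨R.refl x hx.1, hx.2, hx.2⟩
  symm := fun h => ⟨R.symm h.1, h.2.2, h.2.1⟩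
  trans := fun h h' => ⟨R.trans h.1 h'.1, h.2.1, h'.2.2⟩
  countable_classes := fun x =>
    Set.Countable.mono (fun y hy => hy.1) (R.countable_classes x)

/-- `S` is a subrelation of `R`. -/
def CBER.IsSubrelOf {X : Type} [MeasurableSpace X] (S R : CBER X) : Prop :=
  S.dom ⊆ R.dom ∧ ∀ x y, S.rel x y → R.rel x y

/-- A partial Borel isomorphism between Borel subsets `src` and `tgt` of `X`. -/
structure PBI (X : Type) [MeasurableSpace X] where
  src : Set X
  tgt : Set X
  src_meas : MeasurableSet src
  tgt_meas : MeasurableSet tgt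
  toFun : X → X
  invFun : X → X
  meas_toFun : Measurable toFun
  meas_invFun : Measurable invFun
  mapsTo : Set.MapsTo toFun src tgt
  mapsTo_inv : Set.MapsTo invFun tgt src
  left_inv : ∀ x ∈ src, invFun (toFun x) = x
  right_inv : ∀ y ∈ tgt, toFun (invFun y) = y

/-- Membership in the full pseudogroup `[[R]]`: a partial Borel isomorphism whose
graph is contained in `R`. -/
def CBER.InPseudogroup {X : Type} [MeasurableSpace X] (R : CBER X) (φ : PBI X) : Prop :=
  φ.src ⊆ R.dom ∧ ∀ x ∈ φ.src, R.rel x (φ.toFun x)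

/-- Two subrelations `S₁`, `S₂` of `R` are inner conjugate in `R` if some element of the
full pseudogroup of `R` with domain `D(S₂)` and target `D(S₁)` conjugates one to the other. -/
def InnerConjugate {X : Type} [MeasurableSpace X] (R S₁ S₂ : CBER X) : Prop :=
  ∃ φ : PBI X, R.InPseudogroup φ ∧ φ.src = S₂.dom ∧ φ.tgt = S₁.dom ∧
    ∀ x ∈ φ.src, ∀ y ∈ φ.src, (S₂.rel x y ↔ S₁.rel (φ.toFun x) (φ.toFun y))

/-- `R` preserves the measure `μ`: every element of its full pseudogroup preserves `μ`. -/
def CBER.IsPMP {X : Type} [MeasurableSpace X] (R : CBER X) (μ : Measure X) : Prop :=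
  ∀ φ : PBI X, R.InPseudogroup φ → ∀ A : Set X, A ⊆ φ.src → MeasurableSet A →
    μ (φ.toFun '' A) = μ A

/-- Free independence of a family of equivalence relations: any cycle alternating
nontrivially among the factors must have two consecutive steps in the same factor. -/
def FreelyIndep {X : Type} [MeasurableSpace X] {ι : Type} (Rf : ι → CBER X) : Prop :=
  ∀ (n : ℕ) (x : ℕ → X) (i : ℕ → ι), 2 ≤ n → x n = x 0 →
    (∀ j < n, x j ≠ x (j + 1)) → (∀ j < n, (Rf (i j)).rel (x j) (x (j + 1))) →
    ∃ j, j + 1 < n ∧ i j = i (j + 1)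

/-- `R` is the free product of the family `Rf`: the family is freely independent and `R`
is the smallest equivalence relation on the union of the domains containing every `Rf i`. -/
def IsFreeProduct {X : Type} [MeasurableSpace X] {ι : Type} (R : CBER X)
    (Rf : ι → CBER X) : Prop :=
  FreelyIndep Rf ∧ R.dom = (⋃ i, (Rf i).dom) ∧
    ∀ x y, R.rel x y ↔
      (x ∈ R.dom ∧ Relation.EqvGen (fun a b => ∃ i, (Rf i).rel a b) x y)

/-- The partition `U = ⊔ⱼ Uⱼ` trivializes the free product decomposition `R = *ⱼ Rf j`:
`U` is a complete section for `R`, the partition is `R|U`-invariant, and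
`R|Uⱼ = (Rf j)|Uⱼ` for every `j`. -/
def Trivializes {X : Type} [MeasurableSpace X] {ι : Type}
    (R : CBER X) (Rf : ι → CBER X) (U : ι → Set X) : Prop :=
  (∀ j, MeasurableSet (U j)) ∧ (∀ j, U j ⊆ R.dom) ∧
  Pairwise (Function.onFun Disjoint U) ∧
  (∀ x ∈ R.dom, ∃ y ∈ ⋃ j, U j, R.rel x y) ∧
  (∀ i j : ι, ∀ x ∈ U i, ∀ y ∈ U j, R.rel x y → i = j) ∧
  (∀ j, ∀ x ∈ U j, ∀ y ∈ U j, (R.rel x y ↔ (Rf j).rel x y))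

/-- A free product decomposition is inessential if it admits a trivialization. -/
def Inessential {X : Type} [MeasurableSpace X] {ι : Type}
    (R : CBER X) (Rf : ι → CBER X) : Prop :=
  ∃ U : ι → Set X, Trivializes R Rf U

/-- Freely indecomposable (Borel context): every free product decomposition is inessential. -/
def FreelyIndecomposable {X : Type} [MeasurableSpace X] (R : CBER X) : Prop :=
  ∀ (ι : Type) (_ : Countable ι) (Rf : ι → CBER X), IsFreeProduct R Rf → Inessential R Rf

/-- Inessential decomposition in the measured context: a trivialization up to `μ`-null sets. -/
def InessentialMod {X : Type} [MeasurableSpace X] (μ : Measure X) {ι : Type}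
    (R : CBER X) (Rf : ι → CBER X) : Prop :=
  ∃ (U : ι → Set X) (C : Set X),
    (∀ j, MeasurableSet (U j)) ∧ (∀ j, U j ⊆ R.dom) ∧
    Pairwise (Function.onFun Disjoint U) ∧
    MeasurableSet C ∧ μ Cᶜ = 0 ∧
    (∀ x ∈ R.dom ∩ C, ∃ y ∈ ⋃ j, U j, R.rel x y) ∧
    (∀ i j : ι, ∀ x ∈ U i ∩ C, ∀ y ∈ U j ∩ C, R.rel x y → i = j) ∧
    (∀ j, ∀ x ∈ U j ∩ C, ∀ y ∈ U j ∩ C, (R.rel x y ↔ (Rf j).rel x y))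

/-- Freely indecomposable (measured context): every free product decomposition is
inessential up to `μ`-null sets. -/
def FreelyIndecomposableMod {X : Type} [MeasurableSpace X] (μ : Measure X)
    (R : CBER X) : Prop :=
  ∀ (ι : Type) (_ : Countable ι) (Rf : ι → CBER X), IsFreeProduct R Rf →
    InessentialMod μ R Rf

/-- One step of a word in a graphing: apply `φ` (if `e = true`) or `φ⁻¹` (if `e = false`). -/
def PBIStep {X : Type} [MeasurableSpace X] (φ : PBI X) : Bool → X → X → Prop
  | true, a, b => a ∈ φ.src ∧ φ.toFun a = b
  | false, a, b => a ∈ φ.tgt ∧ φ.invFun a = b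

/-- A treeing: any cyclic word in the generators and their inverses admits a reduction. -/
def IsTreeing {X : Type} [MeasurableSpace X] {ι : Type} (Φ : ι → PBI X) : Prop :=
  ∀ (n : ℕ) (i : ℕ → ι) (ε : ℕ → Bool) (x : ℕ → X),
    0 < n → x n = x 0 → (∀ j < n, PBIStep (Φ (i j)) (ε j) (x j) (x (j + 1))) →
    ∃ j, j + 1 < n ∧ i j = i (j + 1) ∧ ε j ≠ ε (j + 1)

/-- The graphing `Φ` generates `R`: `R` is the smallest equivalence relation on the union of
the sources and targets containing the graphs of the `Φ i`. -/
def GeneratesCBER {X : Type} [MeasurableSpace X] {ι : Type} (Φ : ι → PBI X)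
    (R : CBER X) : Prop :=
  R.dom = (⋃ i, ((Φ i).src ∪ (Φ i).tgt)) ∧ (∀ i, R.InPseudogroup (Φ i)) ∧
    ∀ x y, R.rel x y ↔ (x ∈ R.dom ∧
      Relation.EqvGen (fun a b => ∃ i, a ∈ (Φ i).src ∧ (Φ i).toFun a = b) x y)

/-- Treeable: generated by some (countable) treeing. -/
def CBER.Treeable {X : Type} [MeasurableSpace X] (R : CBER X) : Prop :=
  ∃ Φ : ℕ → PBI X, IsTreeing Φ ∧ GeneratesCBER Φ R

/-- Hyperfinite: increasing union of finite Borel subrelations. -/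
def CBER.Hyperfinite {X : Type} [MeasurableSpace X] (R : CBER X) : Prop :=
  ∃ S : ℕ → CBER X, (∀ n, (S n).IsSubrelOf R) ∧ (∀ n, (S n).FiniteClasses) ∧
    (∀ n, (S n).dom = R.dom) ∧ (∀ n, ∀ x y, (S n).rel x y → (S (n + 1)).rel x y) ∧
    ∀ x y, R.rel x y → ∃ n, (S n).rel x y

/-- Ergodicity of a measured CBER: every invariant Borel set is null or conull. -/
def ErgodicCBER {X : Type} [MeasurableSpace X] (R : CBER X) (μ : Measure X) : Prop :=
  ∀ A : Set X, MeasurableSet A → (∀ x ∈ A, ∀ y, R.rel x y → y ∈ A) →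
    μ A = 0 ∨ μ Aᶜ = 0

/-- A stable orbit equivalence between measured CBERs: a Borel isomorphism between
complete sections (mod null sets), sending the normalized measure to the normalized
measure, and preserving the relations a.e. -/
structure SOEquiv {X Y : Type} [MeasurableSpace X] [MeasurableSpace Y]
    (R : CBER X) (μ : Measure X) (S : CBER Y) (ν : Measure Y) where
  A : Set X
  B : Set Y
  toFun : X → Y
  invFun : Y → X
  measA : MeasurableSet A
  measB : MeasurableSet B
  A_sub : A ⊆ R.dom
  B_sub : B ⊆ S.dom
  A_pos : 0 < μ A
  B_pos : 0 < ν B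
  A_section : ∀ᵐ x ∂μ, x ∈ R.dom → ∃ y ∈ A, R.rel x y
  B_section : ∀ᵐ y ∂ν, y ∈ S.dom → ∃ z ∈ B, S.rel y z
  meas_toFun : Measurable toFun
  meas_invFun : Measurable invFun
  mapsTo : Set.MapsTo toFun A B
  mapsTo_inv : Set.MapsTo invFun B A
  left_inv : ∀ x ∈ A, invFun (toFun x) = x
  right_inv : ∀ y ∈ B, toFun (invFun y) = y
  measure_eq : ∀ E : Set X, E ⊆ A → MeasurableSet E →
    (μ A)⁻¹ * μ E = (ν B)⁻¹ * ν (toFun '' E)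
  rel_iff : ∃ C : Set X, MeasurableSet C ∧ μ (A \ C) = 0 ∧
    ∀ x ∈ A ∩ C, ∀ y ∈ A ∩ C, (R.rel x y ↔ S.rel (toFun x) (toFun y))

/-- Stable orbit equivalence. -/
def SOE {X Y : Type} [MeasurableSpace X] [MeasurableSpace Y]
    (R : CBER X) (μ : Measure X) (S : CBER Y) (ν : Measure Y) : Prop :=
  Nonempty (SOEquiv R μ S ν)

/-- Orbit equivalence: a stable orbit equivalence where one can take the complete
sections to be the full spaces. -/
def OE {X Y : Type} [MeasurableSpace X] [MeasurableSpace Y]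
    (R : CBER X) (μ : Measure X) (S : CBER Y) (ν : Measure Y) : Prop :=
  ∃ E : SOEquiv R μ S ν, E.A = Set.univ ∧ E.B = Set.univ

/-- A probability measure preserving action of a group `G` on a measured space. -/
structure PMPAction (G : Type) [Group G] (X : Type) [MeasurableSpace X]
    (μ : Measure X) where
  act : G → X → X
  act_one : ∀ x, act 1 x = x
  act_mul : ∀ g h x, act (g * h) x = act g (act h x)
  measurePreserving : ∀ g, MeasurePreserving (act g) μ μ

/-- Essential freeness: a.e. point has trivial stabilizer. -/
def PMPAction.IsFree {G X : Type} [Group G] [MeasurableSpace X] {μ : Measure X}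
    (α : PMPAction G X μ) : Prop :=
  ∀ᵐ x ∂μ, ∀ g : G, α.act g x = x → g = 1

/-- `R` is the orbit equivalence relation of the action `α` restricted to the subgroup `H`. -/
def IsOrbitRel {G X : Type} [Group G] [MeasurableSpace X] {μ : Measure X}
    (α : PMPAction G X μ) (H : Subgroup G) (R : CBER X) : Prop :=
  R.dom = Set.univ ∧ ∀ x y, (R.rel x y ↔ ∃ g ∈ H, α.act g x = y)

/-- A countable group is measurably freely indecomposable (MFI) if the orbit equivalence
relation of every free p.m.p. action of it on a standard probability space is freely
indecomposable. -/
def MFI (G : Type) [Group G] [Countable G] : Prop :=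
  ∀ (X : Type) [MeasurableSpace X] [StandardBorelSpace X]
    (μ : Measure X) [IsProbabilityMeasure μ]
    (α : PMPAction G X μ) (R : CBER X),
    α.IsFree → IsOrbitRel α ⊤ R → FreelyIndecomposableMod μ R

/-- `G` is the internal free product of the family of subgroups `H`. -/
def IsFreeProductOf (G : Type) [Group G] {ι : Type} (H : ι → Subgroup G) : Prop :=
  Function.Bijective (Monoid.CoprodI.lift fun i => (H i).subtype)

/-- A Borel fundamental domain for an action, of the coupling kind: meets a.e. orbit,
and meets each orbit at most once mod null. -/
def IsFundamentalDomainFor {G : Type} [Group G] {Ω : Type} [MeasurableSpace Ω]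
    (ν : Measure Ω) (a : G → Ω → Ω) (D : Set Ω) : Prop :=
  MeasurableSet D ∧ (∀ᵐ x ∂ν, ∃ g : G, a g x ∈ D) ∧
    ∀ g : G, g ≠ 1 → ν (D ∩ a g ⁻¹' D) = 0

/-- A measure equivalence coupling between `G` and `H`: a standard σ-finite measure space
with commuting measure-preserving essentially free actions of `G` and `H`, each admitting
a Borel fundamental domain of finite positive measure. -/
structure MECoupling (G : Type) [Group G] (H : Type) [Group H] where
  (Ω : Type)
  [mΩ : MeasurableSpace Ω]
  [sbΩ : StandardBorelSpace Ω]
  (ν : Measure Ω)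
  sigmaFinite : SigmaFinite ν
  aG : G → Ω → Ω
  aH : H → Ω → Ω
  DG : Set Ω
  DH : Set Ω
  aG_one : ∀ x, aG 1 x = x
  aG_mul : ∀ g g' x, aG (g * g') x = aG g (aG g' x)
  aH_one : ∀ x, aH 1 x = x
  aH_mul : ∀ h h' x, aH (h * h') x = aH h (aH h' x)
  comm : ∀ g h x, aG g (aH h x) = aH h (aG g x)
  mp_aG : ∀ g, MeasurePreserving (aG g) ν ν
  mp_aH : ∀ h, MeasurePreserving (aH h) ν ν
  free_aG : ∀ᵐ x ∂ν, ∀ g, aG g x = x → g = 1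
  free_aH : ∀ᵐ x ∂ν, ∀ h, aH h x = x → h = 1
  fund_DG : IsFundamentalDomainFor ν aG DG
  fund_DH : IsFundamentalDomainFor ν aH DH
  DG_pos : 0 < ν DG
  DG_fin : ν DG < ⊤
  DH_pos : 0 < ν DH
  DH_fin : ν DH < ⊤

/-- The generalized index (compression constant) of a measure equivalence coupling. -/
noncomputable def MECoupling.index {G : Type} [Group G] {H : Type} [Group H]
    (c : MECoupling G H) : ENNReal :=
  c.ν c.DH / c.ν c.DG

/-- Measure equivalence of countable groups. -/
def MeasureEquivalent (G : Type) [Group G] (H : Type) [Group H] : Prop :=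
  Nonempty (MECoupling G H)

/-- Measure equivalence with a prescribed generalized index. -/
def MEwithIndex (G : Type) [Group G] (H : Type) [Group H] (κ : ENNReal) : Prop :=
  ∃ c : MECoupling G H, c.index = κ

open Set ProbabilityTheory
open scoped ENNReal Topology

/-- Inner regularity of images: a continuous image of an analytic set is approximated in measure
from inside by images of compact subsets. -/
theorem exists_compact_subset_lt_measure_image
    {X Z : Type*} [TopologicalSpace X] [PolishSpace X] [MeasurableSpace X] [BorelSpace X]
    [TopologicalSpace Z]
    (μ : Measure X) [IsFiniteMeasure μ] {B : Set Z} (hB : AnalyticSet B) {g : Z → X}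
    (hg : Continuous g) {c : ℝ≥0∞} (hc : c < μ (g '' B)) :
    ∃ K ⊆ B, IsCompact K ∧ c ≤ μ (g '' K) := by
  rw [AnalyticSet] at hB
  rcases hB with rfl | ⟨f, hf, rfl⟩
  · simp at hc
  have hh : Continuous (g ∘ f) := hg.comp hf
  set h := g ∘ f with h_def
  rw [← range_comp, ← h_def, ← image_univ] at hc
  have step : ∀ (S : Set (ℕ → ℕ)) (n : ℕ), c < μ (h '' S) →
      ∃ k, c < μ (h '' {σ ∈ S | σ n ≤ k}) := by
    intro S n hS
    have hU : h '' S = ⋃ k : ℕ, h '' {σ ∈ S | σ n ≤ k} := by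
      rw [← image_iUnion]
      congr 1
      ext σ
      simp only [mem_iUnion, mem_ofPred_eq]
      exact ⟨fun hσ => ⟨σ n, hσ, le_rfl⟩, fun ⟨_, hσ, _⟩ => hσ⟩
    have hmono : Monotone fun k : ℕ => h '' {σ ∈ S | σ n ≤ k} :=
      fun a b hab => image_mono fun σ hσ => ⟨hσ.1, hσ.2.trans hab⟩
    rw [hU, hmono.measure_iUnion, lt_iSup_iff] at hS
    exact hS
  choose! k hk using step
  let T : ℕ → Set (ℕ → ℕ) := fun n =>
    Nat.rec univ (fun n S => {σ ∈ S | σ n ≤ k S n}) n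
  have T_succ : ∀ n, T (n + 1) = {σ ∈ T n | σ n ≤ k (T n) n} := fun n => rfl
  have hT : ∀ n, c < μ (h '' T n) := by
    intro n
    induction n with
    | zero => exact hc
    | succ n ih => exact hk _ _ ih
  let s : ℕ → ℕ := fun n => k (T n) n
  have mem_T : ∀ n σ, σ ∈ T n ↔ ∀ i < n, σ i ≤ s i := by
    intro n
    induction n with
    | zero => intro σ; simp [T]
    | succ n ih =>
      intro σ
      rw [T_succ, mem_ofPred_eq, ih]
      constructor
      · rintro ⟨h1, h2⟩ i hi
        rcases Nat.lt_succ_iff_lt_or_eq.1 hi with hi | rfl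
        exacts [h1 i hi, h2]
      · exact fun h1 => ⟨fun i hi => h1 i (hi.trans n.lt_succ_self), h1 n n.lt_succ_self⟩
  let K : Set (ℕ → ℕ) := univ.pi fun i => Iic (s i)
  have hK : IsCompact K := isCompact_univ_pi fun i => (finite_Iic (s i)).isCompact
  refine ⟨f '' K, image_subset_range _ _, hK.image hf, ?_⟩
  rw [← image_comp, ← h_def, Set.measure_eq_iInf_isOpen]
  refine le_iInf₂ fun O hO => le_iInf fun hOo => ?_
  suffices ∃ n, T n ⊆ h ⁻¹' O by
    obtain ⟨n, hn⟩ := this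
    exact (hT n).le.trans (measure_mono (image_subset_iff.2 hn))
  by_contra! hcon
  choose σ hσT hσO using fun n => not_subset.1 (hcon n)
  obtain ⟨τ, hτK, φ, hφ, hlim⟩ := hK.tendsto_subseq (x := fun n i => min (σ n i) (s i))
    (fun n i _ => mem_Iic.2 (min_le_right _ _))
  have hlim' : Filter.Tendsto (σ ∘ φ) Filter.atTop (𝓝 τ) := by
    rw [tendsto_pi_nhds] at hlim ⊢
    intro i
    refine (hlim i).congr' ?_
    filter_upwards [Filter.eventually_gt_atTop i] with n hn
    exact min_eq_left ((mem_T _ _).1 (hσT (φ n)) i (hn.trans_le (hφ.id_le n)))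
  have : τ ∈ (h ⁻¹' O)ᶜ :=
    (hOo.preimage hh).isClosed_compl.mem_of_tendsto hlim'
      (Filter.Eventually.of_forall fun n => hσO _)
  exact this (hO (mem_image_of_mem _ hτK))

/-- A Suslin set: the projection of a Borel subset of `X × ℝ`. -/
def IsSuslin {X : Type*} [MeasurableSpace X] (s : Set X) : Prop :=
  ∃ B : Set (X × ℝ), MeasurableSet B ∧ s = {x | ∃ y, (x, y) ∈ B}

section
variable {X Y : Type*} [MeasurableSpace X] [MeasurableSpace Y]

theorem MeasurableSet.exists_real_fiber [StandardBorelSpace Y] {B : Set (X × Y)}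
    (hB : MeasurableSet B) : IsSuslin {x | ∃ y, (x, y) ∈ B} := by
  obtain ⟨e, he⟩ := exists_measurableEmbedding_real Y
  refine ⟨Prod.map id e '' B, (MeasurableEmbedding.id.prodMap he).measurableSet_image.2 hB, ?_⟩
  ext x
  constructor
  · rintro ⟨y, hy⟩
    exact ⟨e y, (x, y), hy, rfl⟩
  · rintro ⟨_, ⟨x', y⟩, hy, h⟩
    obtain ⟨rfl, -⟩ := Prod.ext_iff.1 h
    exact ⟨y, hy⟩

theorem MeasurableSet.isSuslin {s : Set X} (hs : MeasurableSet s) : IsSuslin s :=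
  ⟨s ×ˢ univ, hs.prod .univ, by ext; simp⟩

theorem IsSuslin.exists [StandardBorelSpace Y] {s : Set (X × Y)} (hs : IsSuslin s) :
    IsSuslin {x | ∃ y, (x, y) ∈ s} := by
  obtain ⟨B, hB, rfl⟩ := hs
  have := (MeasurableSet.exists_real_fiber (X := X) (Y := Y × ℝ)
    (B := {q | ((q.1, q.2.1), q.2.2) ∈ B}) (by
      refine measurableSet_preimage (f := fun q : X × Y × ℝ => ((q.1, q.2.1), q.2.2)) ?_ hB
      fun_prop))
  simpa using this

theorem IsSuslin.preimage {s : Set X} (hs : IsSuslin s) {f : Y → X} (hf : Measurable f) :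
    IsSuslin (f ⁻¹' s) := by
  obtain ⟨B, hB, rfl⟩ := hs
  exact ⟨(fun q : Y × ℝ => (f q.1, q.2)) ⁻¹' B, measurableSet_preimage (by fun_prop) hB, rfl⟩

theorem IsSuslin.inter {s t : Set X} (hs : IsSuslin s) (ht : IsSuslin t) :
    IsSuslin (s ∩ t) := by
  obtain ⟨B, hB, rfl⟩ := hs
  obtain ⟨D, hD, rfl⟩ := ht
  have hm : MeasurableSet {q : X × ℝ × ℝ | (q.1, q.2.1) ∈ B ∧ (q.1, q.2.2) ∈ D} :=
    (measurableSet_preimage (f := fun q : X × ℝ × ℝ => (q.1, q.2.1)) (by fun_prop) hB).inter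
      (measurableSet_preimage (f := fun q : X × ℝ × ℝ => (q.1, q.2.2)) (by fun_prop) hD)
  convert hm.exists_real_fiber using 1
  ext x
  simp

theorem IsSuslin.iUnion {ι : Sort*} [Countable ι] {s : ι → Set X} (hs : ∀ i, IsSuslin (s i)) :
    IsSuslin (⋃ i, s i) := by
  choose B hB hs using hs
  refine ⟨⋃ i, B i, .iUnion hB, ?_⟩
  ext x
  simp only [hs, mem_iUnion, mem_ofPred_eq]
  exact exists_comm

theorem exists_compact_fiber [TopologicalSpace X] [PolishSpace X] [BorelSpace X]
    (μ : Measure X) [IsFiniteMeasure μ] {B : Set (X × ℝ)} (hB : MeasurableSet B)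
    {c : ℝ≥0∞} (hc : c < μ {x | ∃ y, (x, y) ∈ B}) :
    ∃ K ⊆ B, IsCompact K ∧ c ≤ μ (Prod.fst '' K) := by
  refine exists_compact_subset_lt_measure_image μ hB.analyticSet continuous_fst ?_
  convert hc
  ext; simp

/-- Suslin sets are universally measurable. -/
theorem IsSuslin.nullMeasurableSet [StandardBorelSpace X] {s : Set X} (hs : IsSuslin s)
    (μ : Measure X) [IsFiniteMeasure μ] : NullMeasurableSet s μ := by
  let := upgradeStandardBorel X
  obtain ⟨B, hB, rfl⟩ := hs
  set s := {x | ∃ y, (x, y) ∈ B}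
  have key : ∀ c < μ s, ∃ t ⊆ s, MeasurableSet t ∧ c ≤ μ t := by
    intro c hc
    obtain ⟨K, hKB, hK, h⟩ := exists_compact_fiber μ hB hc
    refine ⟨_, ?_, (hK.image continuous_fst).measurableSet, h⟩
    rintro _ ⟨⟨x, y⟩, hxy, rfl⟩
    exact ⟨y, hKB hxy⟩
  by_cases h0 : μ s = 0
  · exact NullMeasurableSet.of_null h0
  obtain ⟨c, -, hc, hlim⟩ := exists_seq_strictMono_tendsto' (pos_iff_ne_zero.2 h0)
  choose t hts htm htc using fun n => key (c n) (hc n).2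
  have hsub : (⋃ n, t n) ⊆ s := iUnion_subset hts
  have hle : μ s ≤ μ (⋃ n, t n) :=
    le_of_tendsto' hlim fun n => (htc n).trans (measure_mono (subset_iUnion t n))
  exact (MeasurableSet.iUnion htm).nullMeasurableSet.congr
    (ae_eq_of_subset_of_measure_ge hsub hle (MeasurableSet.iUnion htm).nullMeasurableSet
      (measure_ne_top _ _))

/-- A Borel set with non-null projection has a Borel section over a non-null Borel set. -/
theorem exists_measurable_selection [StandardBorelSpace X] [StandardBorelSpace Y]
    (μ : Measure X) [IsFiniteMeasure μ] {B : Set (X × Y)} (hB : MeasurableSet B)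
    (hpos : μ {x | ∃ y, (x, y) ∈ B} ≠ 0) :
    ∃ (A : Set X) (s : X → Y), MeasurableSet A ∧ μ A ≠ 0 ∧ Measurable s ∧
      ∀ x ∈ A, (x, s x) ∈ B := by
  let := upgradeStandardBorel X
  obtain ⟨e, he⟩ := exists_measurableEmbedding_real Y
  have hBe : MeasurableSet (Prod.map id e '' B : Set (X × ℝ)) :=
    (MeasurableEmbedding.id.prodMap he).measurableSet_image.2 hB
  have hset : {x | ∃ y, (x, y) ∈ (Prod.map id e '' B : Set (X × ℝ))} = {x | ∃ y, (x, y) ∈ B} := by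
    ext x
    simp
  obtain ⟨c, hc0, hc⟩ := exists_between (pos_iff_ne_zero.2 hpos)
  obtain ⟨K, hKB, hK, hKμ⟩ := exists_compact_fiber μ hBe (hset ▸ hc)
  have hA : IsCompact (Prod.fst '' K) := hK.image continuous_fst
  have hAm : MeasurableSet (Prod.fst '' K) := hA.measurableSet
  have hfib : ∀ x, IsCompact {y | (x, y) ∈ K} := fun x => by
    refine (hK.image continuous_snd).of_isClosed_subset
      (hK.isClosed.preimage (Continuous.prodMk_right x)) fun y hy => ⟨(x, y), hy, rfl⟩
  have hmem : ∀ x ∈ Prod.fst '' K, (x, sInf {y | (x, y) ∈ K}) ∈ K := by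
    rintro _ ⟨⟨x, y⟩, hxy, rfl⟩
    exact (hfib x).sInf_mem ⟨y, hxy⟩
  have hne : Nonempty Y := by
    obtain ⟨x, y, hy⟩ := nonempty_of_measure_ne_zero hpos
    exact ⟨y⟩
  have hm₀ : Measurable fun x : Prod.fst '' K => sInf {y | ((x : X), y) ∈ K} := by
    refine measurable_of_Iic fun q => ?_
    have : (fun x : Prod.fst '' K => sInf {y | ((x : X), y) ∈ K}) ⁻¹' Iic q =
        Subtype.val ⁻¹' (Prod.fst '' (K ∩ {z | z.2 ≤ q})) := by
      ext ⟨x, hx⟩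
      simp only [mem_preimage, mem_Iic]
      constructor
      · exact fun h => ⟨_, ⟨hmem x hx, h⟩, rfl⟩
      · rintro ⟨⟨x', y⟩, ⟨h1, h2⟩, rfl⟩
        exact (csInf_le (hfib x').bddBelow h1).trans h2
    show MeasurableSet ((fun x : Prod.fst '' K => sInf {y | ((x : X), y) ∈ K}) ⁻¹' Iic q)
    rw [this]
    refine measurable_subtype_coe (IsCompact.measurableSet ?_)
    exact (hK.inter_right (isClosed_le continuous_snd continuous_const)).image continuous_fst
  obtain ⟨r, hr, hre⟩ := he.exists_measurable_extend measurable_id fun _ => hne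
  obtain ⟨m, hm, hme⟩ := (MeasurableEmbedding.subtype_coe hAm).exists_measurable_extend hm₀
    fun _ => ⟨0⟩
  refine ⟨Prod.fst '' K, r ∘ m, hAm, (hc0.trans_le hKμ).ne', hr.comp hm, fun x hx => ?_⟩
  obtain ⟨⟨x', y⟩, hxy, h⟩ := hKB (hmem x hx)
  have h1 : x' = x := congrArg Prod.fst h
  have h2 : e y = sInf {y | (x, y) ∈ K} := congrArg Prod.snd h
  have h3 : m x = sInf {y | (x, y) ∈ K} := congrFun hme ⟨x, hx⟩
  have h4 : r (e y) = y := congrFun hre y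
  rwa [Function.comp_apply, h3, ← h2, h4, ← h1]

end

/-- A countable-to-one Borel map is injective on some non-null Borel subset. -/
theorem exists_injOn_of_countable_fibers {X Y : Type*} [MeasurableSpace X] [MeasurableSpace Y]
    [StandardBorelSpace X] [StandardBorelSpace Y]
    (μ : Measure X) [IsFiniteMeasure μ] {A : Set X} (hA : MeasurableSet A) (hpos : μ A ≠ 0)
    {g : X → Y} (hg : Measurable g) (hc : ∀ y, {x | x ∈ A ∧ g x = y}.Countable) :
    ∃ A' ⊆ A, MeasurableSet A' ∧ μ A' ≠ 0 ∧ InjOn g A' := by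
  have hne : Nonempty X := (nonempty_of_measure_ne_zero hpos).to_type
  set ρ := μ.restrict A
  let κ : Kernel Y X := condDistrib id g ρ
  have hκ : (ρ.map g) ⊗ₘ κ = ρ.map (fun x => (g x, x)) :=
    compProd_map_condDistrib measurable_id.aemeasurable
  have hgm : Measurable fun x : X => (g x, x) := by fun_prop
  have hmeasS : MeasurableSet {q : Y × X | q.2 ∈ A ∧ g q.2 = q.1} :=
    (measurable_snd hA).inter (measurableSet_eq_fun (hg.comp measurable_snd) measurable_fst)
  have hae : ∀ᵐ y ∂ρ.map g, ∀ᵐ x ∂κ y, x ∈ A ∧ g x = y := by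
    refine Measure.ae_ae_of_ae_compProd (p := fun q : Y × X => q.2 ∈ A ∧ g q.2 = q.1) ?_
    rw [hκ, ae_map_iff hgm.aemeasurable hmeasS]
    filter_upwards [ae_restrict_mem hA] with x hx using ⟨hx, rfl⟩
  have hatom : Measurable fun q : Y × X => κ q.1 {q.2} := by
    have := Kernel.measurable_kernel_prodMk_left (κ := Kernel.prodMkRight X κ)
      (t := {q : (Y × X) × X | q.2 = q.1.2})
      (measurableSet_eq_fun measurable_snd (measurable_snd.comp measurable_fst))
    exact this
  have hB : MeasurableSet {q : Y × X | (q.2 ∈ A ∧ g q.2 = q.1) ∧ κ q.1 {q.2} ≠ 0} :=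
    hmeasS.inter (hatom (measurableSet_singleton 0).compl)
  have hρ : ρ univ ≠ 0 := by simpa [ρ] using hpos
  have hBpos : ρ.map g {y | ∃ x, (y, x) ∈
      {q : Y × X | (q.2 ∈ A ∧ g q.2 = q.1) ∧ κ q.1 {q.2} ≠ 0}} ≠ 0 := by
    have hfull : ∀ᵐ y ∂ρ.map g, y ∈ {y | ∃ x, (y, x) ∈
      {q : Y × X | (q.2 ∈ A ∧ g q.2 = q.1) ∧ κ q.1 {q.2} ≠ 0}} := by
      filter_upwards [hae] with y hy
      by_contra hcon
      have hz : κ y {x | x ∈ A ∧ g x = y} = 0 :=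
        (measure_null_iff_singleton (hc y)).2 fun x hx => by
          by_contra h0
          exact hcon ⟨x, hx, h0⟩
      have h1 : κ y univ = 0 := by
        rw [← measure_congr (s := {x | x ∈ A ∧ g x = y})]
        · exact hz
        · exact Filter.eventuallyEq_univ.2 hy
      simp at h1
    intro h0
    have h1 : ρ.map g univ = 0 :=
      (measure_congr (Filter.eventuallyEq_univ.2 hfull)).symm.trans h0
    rw [Measure.map_apply hg .univ] at h1
    exact hρ h1
  obtain ⟨D, s, hD, hDpos, hs, hsB⟩ := exists_measurable_selection (ρ.map g) hB hBpos
  have hgs : ∀ y ∈ D, g (s y) = y := fun y hy => (hsB y hy).1.2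
  have hsinj : InjOn s D := fun a ha b hb hab => by rw [← hgs a ha, ← hgs b hb, hab]
  have hA' : MeasurableSet (s '' D) := hD.image_of_measurable_injOn hs hsinj
  refine ⟨s '' D, ?_, hA', ?_, ?_⟩
  · rintro _ ⟨y, hy, rfl⟩
    exact (hsB y hy).1.1
  · intro h0
    have h1 : ρ (s '' D) = 0 := Measure.absolutelyContinuous_of_le Measure.restrict_le_self h0
    have h2 : (ρ.map g ⊗ₘ κ) (univ ×ˢ (s '' D)) = 0 := by
      rw [hκ, Measure.map_apply hgm (MeasurableSet.univ.prod hA')]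
      convert h1
      ext; simp
    rw [Measure.compProd_apply (MeasurableSet.univ.prod hA'),
      lintegral_eq_zero_iff (Kernel.measurable_kernel_prodMk_left (MeasurableSet.univ.prod hA'))]
      at h2
    refine hDpos (measure_mono_null (fun y hy => ?_) h2)
    refine fun h3 => (hsB y hy).2 (measure_mono_null ?_ h3)
    rintro _ rfl
    exact ⟨mem_univ _, mem_image_of_mem _ hy⟩
  · rintro _ ⟨a, ha, rfl⟩ _ ⟨b, hb, rfl⟩ hab
    rw [hgs a ha, hgs b hb] at hab
    rw [hab]

namespace CBER
variable {X : Type} [MeasurableSpace X] [StandardBorelSpace X]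

/-- Both projections of a Borel partial bijection contained in `R` have the same measure. -/
theorem IsPMP.measure_image_fst_eq {R : CBER X} {μ : Measure X} (hR : R.IsPMP μ)
    {G : Set (X × X)} (hG : MeasurableSet G) (hGR : ∀ q ∈ G, R.rel q.1 q.2)
    (h1 : InjOn Prod.fst G) (h2 : InjOn Prod.snd G) :
    μ (Prod.fst '' G) = μ (Prod.snd '' G) := by
  rcases isEmpty_or_nonempty X with hX | hX
  · simp [Set.eq_empty_of_isEmpty]
  have := hG.standardBorel
  have e1 : MeasurableEmbedding fun q : G => q.1.1 :=
    Measurable.measurableEmbedding (by fun_prop) fun a b hab => Subtype.ext (h1 a.2 b.2 hab)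
  have e2 : MeasurableEmbedding fun q : G => q.1.2 :=
    Measurable.measurableEmbedding (by fun_prop) fun a b hab => Subtype.ext (h2 a.2 b.2 hab)
  obtain ⟨f, hf, hfe⟩ := e1.exists_measurable_extend e2.measurable fun _ => hX
  obtain ⟨f', hf', hfe'⟩ := e2.exists_measurable_extend e1.measurable fun _ => hX
  have key : ∀ q ∈ G, f q.1 = q.2 := fun q hq => congrFun hfe ⟨q, hq⟩
  have key' : ∀ q ∈ G, f' q.2 = q.1 := fun q hq => congrFun hfe' ⟨q, hq⟩
  let φ : PBI X :=
    { src := Prod.fst '' G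
      tgt := Prod.snd '' G
      src_meas := hG.image_of_measurable_injOn measurable_fst h1
      tgt_meas := hG.image_of_measurable_injOn measurable_snd h2
      toFun := f
      invFun := f'
      meas_toFun := hf
      meas_invFun := hf'
      mapsTo := by
        rintro _ ⟨q, hq, rfl⟩
        exact ⟨q, hq, (key q hq).symm⟩
      mapsTo_inv := by
        rintro _ ⟨q, hq, rfl⟩
        exact ⟨q, hq, (key' q hq).symm⟩
      left_inv := by
        rintro _ ⟨q, hq, rfl⟩
        rw [key q hq, key' q hq]
      right_inv := by
        rintro _ ⟨q, hq, rfl⟩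
        rw [key' q hq, key q hq] }
  have hφ : R.InPseudogroup φ := by
    constructor
    · rintro _ ⟨q, hq, rfl⟩
      exact (R.rel_dom (hGR q hq)).1
    · rintro _ ⟨q, hq, rfl⟩
      show R.rel q.1 (f q.1)
      rw [key q hq]
      exact hGR q hq
  have himg : f '' (Prod.fst '' G) = Prod.snd '' G := by
    rw [← image_comp]
    exact image_congr key
  rw [← himg]
  exact (hR φ hφ _ subset_rfl φ.src_meas).symm

/-- Saturations of null sets are null. -/
theorem IsPMP.measure_sat_eq_zero {R : CBER X} {μ : Measure X} [IsFiniteMeasure μ]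
    (hR : R.IsPMP μ) {N : Set X} (hN : μ N = 0) : μ (R.sat N) = 0 := by
  obtain ⟨N', hNN', hN'm, hN'⟩ := exists_measurable_superset_of_null hN
  by_contra hpos
  have hB : MeasurableSet {q : X × X | R.rel q.1 q.2 ∧ q.2 ∈ N'} :=
    R.rel_meas.inter (measurable_snd hN'm)
  have hsub : R.sat N ⊆ {x | ∃ y, (x, y) ∈ {q : X × X | R.rel q.1 q.2 ∧ q.2 ∈ N'}} :=
    fun y ⟨x, hx, hxy⟩ => ⟨x, R.symm hxy, hNN' hx⟩
  obtain ⟨A, s, hA, hApos, hs, hsB⟩ := exists_measurable_selection μ hB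
    fun h0 => hpos (measure_mono_null hsub h0)
  obtain ⟨A', hA'A, hA', hA'pos, hinj⟩ := exists_injOn_of_countable_fibers μ hA hApos hs
    (fun y => (R.countable_classes y).mono (by
      rintro x ⟨hx, rfl⟩
      exact R.symm (hsB x hx).1))
  have hG : MeasurableSet ((fun x => (x, s x)) '' A') :=
    hA'.image_of_measurable_injOn (by fun_prop) fun a _ b _ hab => congrArg Prod.fst hab
  have := hR.measure_image_fst_eq hG
    (by rintro _ ⟨x, hx, rfl⟩; exact (hsB x (hA'A hx)).1)
    (by rintro _ ⟨x, hx, rfl⟩ _ ⟨y, hy, rfl⟩ (h : x = y); rw [h])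
    (by rintro _ ⟨x, hx, rfl⟩ _ ⟨y, hy, rfl⟩ (h : s x = s y); rw [hinj hx hy h])
  rw [← image_comp, ← image_comp] at this
  refine hA'pos ?_
  have h1 : Prod.fst ∘ (fun x => (x, s x)) = (id : X → X) := rfl
  rw [h1, image_id] at this
  rw [this]
  refine measure_mono_null ?_ hN'
  rintro _ ⟨x, hx, rfl⟩
  have hxA : x ∈ A := hA'A hx
  exact (hsB x hxA).2

/-- Every conull set contains an invariant conull Borel set. -/
theorem IsPMP.exists_invariant_conull_subset {R : CBER X} {μ : Measure X} [IsFiniteMeasure μ]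
    (hR : R.IsPMP μ) {A : Set X} (hA : μ Aᶜ = 0) :
    ∃ Z ⊆ A, MeasurableSet Z ∧ μ Zᶜ = 0 ∧ ∀ x y, R.rel x y → x ∈ Z → y ∈ Z := by
  have step : ∀ S : Set X, μ Sᶜ = 0 → ∃ T, T ⊆ S ∧ MeasurableSet T ∧ μ Tᶜ = 0 ∧
      ∀ x y, R.rel x y → x ∈ T → y ∈ S := by
    intro S hS
    have h0 : μ (Sᶜ ∪ R.sat Sᶜ) = 0 := measure_union_null hS (hR.measure_sat_eq_zero hS)
    obtain ⟨N, hN, hNm, hN0⟩ := exists_measurable_superset_of_null h0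
    refine ⟨Nᶜ, ?_, hNm.compl, by rwa [compl_compl], ?_⟩
    · intro x hx
      by_contra hxS
      exact hx (hN (Or.inl hxS))
    · intro x y hxy hx
      by_contra hyS
      exact hx (hN (Or.inr ⟨y, hyS, R.symm hxy⟩))
  choose! T hTS hTm hT0 hTr using step
  let S : ℕ → Set X := fun n => Nat.rec (T A) (fun _ S => T S) n
  have hS0 : ∀ n, μ (S n)ᶜ = 0 := by
    intro n
    induction n with
    | zero => exact hT0 A hA
    | succ n ih => exact hT0 _ ih
  have hSm : ∀ n, MeasurableSet (S n) := by
    rintro (_ | n)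
    · exact hTm A hA
    · exact hTm _ (hS0 n)
  refine ⟨⋂ n, S n, (iInter_subset S 0).trans (hTS A hA), .iInter hSm, ?_, ?_⟩
  · rw [compl_iInter]
    exact measure_iUnion_null hS0
  · intro x y hxy hx
    rw [mem_iInter] at hx ⊢
    exact fun n => hTr _ (hS0 n) x y hxy (hx (n + 1))

end CBER

section
variable {X ι : Type} [MeasurableSpace X]

/-- `ReducedPath Rf a b x y`: some chain from `x` to `y` moves at each step nontrivially within a
class of the family `Rf`, never uses the same index twice in a row, and has first index `a` and
last index `b`. -/
inductive ReducedPath (Rf : ι → CBER X) : ι → ι → X → X → Prop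
  | single {a : ι} {x y : X} : x ≠ y → (Rf a).rel x y → ReducedPath Rf a a x y
  | cons {a b c : ι} {x w y : X} : x ≠ w → (Rf a).rel x w → a ≠ c → ReducedPath Rf c b w y →
      ReducedPath Rf a b x y

namespace ReducedPath
variable {Rf : ι → CBER X} {a b c d i : ι} {x y z w : X}

theorem append (h : ReducedPath Rf a b x y) (h' : ReducedPath Rf c d y z) (hbc : b ≠ c) :
    ReducedPath Rf a d x z := by
  induction h with
  | single hne hr => exact cons hne hr hbc h'
  | cons hne hr hac _ ih => exact cons hne hr hac (ih h' hbc)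

theorem reverse (h : ReducedPath Rf a b x y) : ReducedPath Rf b a y x := by
  induction h with
  | single hne hr => exact single hne.symm ((Rf _).symm hr)
  | cons hne hr hac _ ih => exact ih.append (single hne.symm ((Rf _).symm hr)) hac.symm

theorem exists_chain (h : ReducedPath Rf a b x y) :
    ∃ (n : ℕ) (u : ℕ → X) (k : ℕ → ι), 1 ≤ n ∧ u 0 = x ∧ u n = y ∧ k 0 = a ∧
      (∀ j < n, u j ≠ u (j + 1)) ∧ (∀ j < n, (Rf (k j)).rel (u j) (u (j + 1))) ∧
      ∀ j, j + 1 < n → k j ≠ k (j + 1) := by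
  induction h with
  | @single a x y hne hr =>
    refine ⟨1, fun j => Nat.casesOn j x fun _ => y, fun _ => a, le_rfl, rfl, rfl, rfl, ?_, ?_, ?_⟩
    · intro j hj
      obtain rfl : j = 0 := by omega
      exact hne
    · intro j hj
      obtain rfl : j = 0 := by omega
      exact hr
    · intro j hj
      omega
  | @cons a b c x w y hne hr hac _ ih =>
    obtain ⟨n, u, k, hn, hu0, hun, hk0, h1, h2, h3⟩ := ih
    refine ⟨n + 1, fun j => Nat.casesOn j x u, fun j => Nat.casesOn j a k, by omega, rfl, hun, rfl,
      ?_, ?_, ?_⟩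
    · rintro (_ | j) hj
      · exact fun h => hne (h.trans hu0)
      · exact h1 j (by omega)
    · rintro (_ | j) hj
      · show (Rf a).rel x (u 0)
        rwa [hu0]
      · exact h2 j (by omega)
    · rintro (_ | j) hj
      · show a ≠ k 0
        rwa [hk0]
      · exact h3 j (by omega)

theorem ne (hfree : FreelyIndep Rf) (h : ReducedPath Rf a b x y) : x ≠ y := by
  rintro rfl
  obtain ⟨n, u, k, hn, hu0, hun, -, h1, h2, h3⟩ := h.exists_chain
  rcases hn.eq_or_lt with rfl | hn
  · exact h1 0 one_pos (hu0.trans hun.symm)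
  · obtain ⟨j, hj, hk⟩ := hfree n u k hn (hun.trans hu0.symm) h1 h2
    exact h3 j hj hk

theorem prepend (hr : (Rf a).rel w x) (h : x = y ∨ ∃ c b, ReducedPath Rf c b x y) :
    w = y ∨ ∃ c b, ReducedPath Rf c b w y := by
  by_cases hwx : w = x
  · rwa [hwx]
  rcases h with rfl | ⟨c, b, h⟩
  · exact Or.inr ⟨a, a, single hwx hr⟩
  by_cases hac : a = c
  · subst hac
    by_cases hwy : w = y
    · exact Or.inl hwy
    cases h with
    | single hne hr' => exact Or.inr ⟨a, a, single hwy ((Rf a).trans hr hr')⟩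
    | @cons _ _ c _ v _ hne hr' hac h =>
      by_cases hwv : w = v
      · exact Or.inr ⟨c, b, hwv ▸ h⟩
      · exact Or.inr ⟨a, b, cons hwv ((Rf a).trans hr hr') hac h⟩
  · exact Or.inr ⟨a, b, cons hwx hr hac h⟩

theorem of_eqvGen (h : Relation.EqvGen (fun u v => ∃ i, (Rf i).rel u v) x y) :
    x = y ∨ ∃ a b, ReducedPath Rf a b x y := by
  have hsymm : Std.Symm (fun u v => ∃ i, (Rf i).rel u v) :=
    ⟨fun _ _ ⟨i, hi⟩ => ⟨i, (Rf i).symm hi⟩⟩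
  rw [Relation.EqvGen.eqvGen_eq_reflTransGen] at h
  induction h using Relation.ReflTransGen.head_induction_on with
  | refl => exact Or.inl rfl
  | head hr _ ih =>
    obtain ⟨i, hi⟩ := hr
    exact prepend hi ih

/-- A reduced path between distinct classes of `Rf i` can be stripped to one which neither starts
nor ends with index `i`, moving its endpoints within these classes. -/
theorem exists_exit (h : ReducedPath Rf a b x y) (hx : x ∈ (Rf i).dom) (hy : y ∈ (Rf i).dom)
    (hxy : ¬ (Rf i).rel x y) :
    ∃ x' y' a' b', (Rf i).rel x x' ∧ (Rf i).rel y y' ∧ a' ≠ i ∧ b' ≠ i ∧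
      ReducedPath Rf a' b' x' y' := by
  have strip : ∀ {a b : ι} {x y : X}, ReducedPath Rf a b x y → x ∈ (Rf i).dom →
      ¬ (Rf i).rel x y → ∃ x' a', (Rf i).rel x x' ∧ a' ≠ i ∧ ReducedPath Rf a' b x' y := by
    intro a b x y h hx hxy
    by_cases hai : a = i
    · subst hai
      cases h with
      | single hne hr => exact absurd hr hxy
      | cons hne hr hac h => exact ⟨_, _, hr, hac.symm, h⟩
    · exact ⟨x, a, (Rf i).refl x hx, hai, h⟩
  obtain ⟨x', a', hxx', ha', h'⟩ := strip h hx hxy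
  obtain ⟨y', b', hyy', hb', h''⟩ := strip h'.reverse hy
    fun hr => hxy ((Rf i).trans hxx' ((Rf i).symm hr))
  exact ⟨x', y', a', b', hxx', hyy', ha', hb', h''.reverse⟩

/-- Two classes of `Rf i` are joined by reduced paths avoiding `i` as first and last index from at
most one point. -/
theorem exit_unique (hfree : FreelyIndep Rf) {x x' y y' : X} {a b a' b' : ι}
    (h : ReducedPath Rf a b x y) (h' : ReducedPath Rf a' b' x' y')
    (ha : a ≠ i) (hb : b ≠ i) (ha' : a' ≠ i) (hb' : b' ≠ i)
    (hx : (Rf i).rel x x') (hy : (Rf i).rel y y') : x = x' := by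
  by_contra hne
  by_cases hyy : y = y'
  · subst hyy
    exact ((h.reverse.append (single hne hx) ha).append h' ha'.symm).ne hfree rfl
  · exact (((h.append (single hyy hy) hb).append h'.reverse hb'.symm).append
      (single (Ne.symm hne) ((Rf i).symm hx)) ha').ne hfree rfl

theorem isSuslin [StandardBorelSpace X] [Countable ι] (Rf : ι → CBER X) (a b : ι) :
    IsSuslin {q : X × X | ReducedPath Rf a b q.1 q.2} := by
  let S : ℕ → ι → Set (X × X) := fun n => Nat.rec
    (fun a => {q | a = b ∧ q.1 ≠ q.2 ∧ (Rf a).rel q.1 q.2})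
    (fun _ S a => ⋃ c, {q | a ≠ c ∧ ∃ w, (q.1 ≠ w ∧ (Rf a).rel q.1 w) ∧ (w, q.2) ∈ S c}) n
  have hS : ∀ n a, IsSuslin (S n a) := by
    intro n
    induction n with
    | zero =>
      intro a
      exact (((MeasurableSet.const _).inter ((measurableSet_eq_fun measurable_fst
        measurable_snd).compl.inter (Rf a).rel_meas))).isSuslin
    | succ n ih =>
      intro a
      refine IsSuslin.iUnion fun c => ?_
      have h1 : MeasurableSet {q : (X × X) × X | q.1.1 ≠ q.2 ∧ (Rf a).rel q.1.1 q.2} :=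
        ((measurableSet_eq_fun (by fun_prop) (by fun_prop)).compl.inter
          (measurableSet_preimage (f := fun q : (X × X) × X => (q.1.1, q.2)) (by fun_prop)
            (Rf a).rel_meas))
      have h2 : IsSuslin ((fun q : (X × X) × X => (q.2, q.1.2)) ⁻¹' S n c) :=
        (ih c).preimage (by fun_prop)
      exact (MeasurableSet.const (a ≠ c)).isSuslin.inter (h1.isSuslin.inter h2).exists
  have hEq : ∀ a, {q : X × X | ReducedPath Rf a b q.1 q.2} = ⋃ n, S n a := by
    intro a
    ext ⟨x, y⟩
    rw [mem_iUnion]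
    constructor
    · intro h
      change ReducedPath Rf a b x y at h
      clear hS
      induction h with
      | single hne hr => exact ⟨0, rfl, hne, hr⟩
      | cons hne hr hac _ ih =>
        obtain ⟨n, hn⟩ := ih
        exact ⟨n + 1, mem_iUnion.2 ⟨_, hac, _, ⟨hne, hr⟩, hn⟩⟩
    · rintro ⟨n, hn⟩
      show ReducedPath Rf a b x y
      induction n generalizing a x with
      | zero =>
        obtain ⟨rfl, hne, hr⟩ := hn
        exact single hne hr
      | succ n ih =>
        obtain ⟨c, hac, w, ⟨hne, hr⟩, hn⟩ := mem_iUnion.1 hn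
        exact cons hne hr hac (ih c w hn)
  rw [hEq]
  exact IsSuslin.iUnion fun n => hS n a

end ReducedPath
end

section
variable {X ι : Type} [MeasurableSpace X]

theorem IsFreeProduct.rel_of_rel {R : CBER X} {Rf : ι → CBER X} (h : IsFreeProduct R Rf) {i : ι}
    {x y : X} (hxy : (Rf i).rel x y) : R.rel x y :=
  (h.2.2 x y).2 ⟨h.2.1 ▸ mem_iUnion.2 ⟨i, ((Rf i).rel_dom hxy).1⟩, .rel _ _ ⟨i, hxy⟩⟩

/-- If a subset `T` of an `R`-class meets at most `m + 1` classes of the factor `Rf i`, then its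
`Rf i`-saturation contains only finitely many endpoints of reduced paths which leave and reenter
that saturation without using `i` as first or last index. -/
theorem IsFreeProduct.finite_exits {R : CBER X} {Rf : ι → CBER X} (h : IsFreeProduct R Rf)
    {i : ι} {m : ℕ} {T : Set X} (hTd : T ⊆ (Rf i).dom) {x : X}
    (hB : ¬ ∃ y : Fin (m + 2) → X, (∀ j, R.rel x (y j) ∧ y j ∈ T) ∧
      Pairwise fun j l => ¬ (Rf i).rel (y j) (y l)) :
    {v | R.rel x v ∧ (∃ t ∈ T, (Rf i).rel v t) ∧ ∃ w, (∃ t ∈ T, (Rf i).rel w t) ∧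
      ∃ a b, a ≠ i ∧ b ≠ i ∧ ReducedPath Rf a b v w}.Finite := by
  let S : Setoid {t // R.rel x t ∧ t ∈ T} :=
    { r := fun s t => (Rf i).rel s t
      iseqv := ⟨fun t => (Rf i).refl t (hTd t.2.2), fun h => (Rf i).symm h,
        fun h h' => (Rf i).trans h h'⟩ }
  have hfin : Finite (Quotient S) := by
    by_contra hinf
    have : Infinite (Quotient S) := not_finite_iff_infinite.1 hinf
    refine hB ⟨fun j => ((Infinite.natEmbedding (Quotient S) j).out).1,
      fun j => (Infinite.natEmbedding (Quotient S) j).out.2, fun j l hjl hr => hjl ?_⟩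
    have h1 : (Infinite.natEmbedding (Quotient S) j) = Infinite.natEmbedding (Quotient S) l :=
      Quotient.out_equiv_out.1 hr
    exact Fin.ext ((Infinite.natEmbedding (Quotient S)).injective h1)
  have hpath : ∀ {a b : ι} {v w : X}, ReducedPath Rf a b v w → R.rel v w := by
    intro a b v w hvw
    induction hvw with
    | single _ hr => exact h.rel_of_rel hr
    | cons _ hr _ _ ih => exact R.trans (h.rel_of_rel hr) ih
  set E := {v | R.rel x v ∧ (∃ t ∈ T, (Rf i).rel v t) ∧ ∃ w, (∃ t ∈ T, (Rf i).rel w t) ∧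
      ∃ a b, a ≠ i ∧ b ≠ i ∧ ReducedPath Rf a b v w}
  have hE : ∀ v : E, ∃ q : Quotient S × Quotient S, ∃ w, ∃ s t : {t // R.rel x t ∧ t ∈ T},
      q = (⟦s⟧, ⟦t⟧) ∧ (Rf i).rel v s ∧ (Rf i).rel w t ∧
      ∃ a b, a ≠ i ∧ b ≠ i ∧ ReducedPath Rf a b v w := by
    rintro ⟨v, hxv, ⟨s, hs, hvs⟩, w, ⟨t, ht, hwt⟩, a, b, ha, hb, hp⟩
    exact ⟨_, w, ⟨s, R.trans hxv (h.rel_of_rel hvs), hs⟩,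
      ⟨t, R.trans hxv (R.trans (hpath hp) (h.rel_of_rel hwt)), ht⟩, rfl, hvs, hwt, a, b, ha, hb, hp⟩
  choose q w s t hq hvs hwt a b ha hb hp using hE
  refine Set.finite_coe_iff.1 (Finite.of_injective q fun v u hvu => Subtype.ext ?_)
  rw [hq, hq, Prod.mk.injEq, Quotient.eq, Quotient.eq] at hvu
  exact (hp v).exit_unique h.1 (hp u) (ha v) (hb v) (ha u) (hb u)
    ((Rf i).trans (hvs v) ((Rf i).trans hvu.1 ((Rf i).symm (hvs u))))
    ((Rf i).trans (hwt v) ((Rf i).trans hvu.2 ((Rf i).symm (hwt u))))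

/-- A free product decomposition is inessential if almost every class meets one of countably many
Borel sets `T (i, m)`, each of which meets at most `m + 1` classes of `Rf i` in almost every
`R`-class. -/
theorem IsFreeProduct.inessentialMod_of_finite_index [StandardBorelSpace X] [Countable ι]
    {R : CBER X} {Rf : ι → CBER X} {μ : Measure X} [IsFiniteMeasure μ] (hR : R.IsPMP μ)
    (hdom : R.dom = univ) (hfp : IsFreeProduct R Rf) {T : ι × ℕ → Set X}
    (hT : ∀ k, MeasurableSet (T k)) (hTd : ∀ k, T k ⊆ (Rf k.1).dom)
    (hA : ∀ᵐ x ∂μ, ∃ k, ∃ y ∈ T k, R.rel x y)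
    (hB : ∀ᵐ x ∂μ, ∀ k, ¬ ∃ y : Fin (k.2 + 2) → X, (∀ j, R.rel x (y j) ∧ y j ∈ T k) ∧
      Pairwise fun j l => ¬ (Rf k.1).rel (y j) (y l)) :
    InessentialMod μ R Rf := by
  obtain ⟨f, hf⟩ := exists_injective_nat (ι × ℕ)
  obtain ⟨e, he⟩ := exists_measurableEmbedding_real X
  let V : ι × ℕ → Set X := fun k => {x | ∃ y, y ∈ T k ∧ (Rf k.1).rel x y}
  let S : ι × ℕ → Set X := fun k => {x | ∃ y, y ∈ T k ∧ R.rel x y}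
  let P : ι × ℕ → Set X := fun k => {x | ∃ y, y ∈ V k ∧ R.rel x y ∧ ¬ (Rf k.1).rel x y}
  let E : ι × ℕ → Set X := fun k => V k ∩ {x | ∃ w, w ∈ V k ∧ ∃ a b, a ≠ k.1 ∧ b ≠ k.1 ∧
    ReducedPath Rf a b x w}
  let N : ι × ℕ → Set X := fun k => {x | ∃ y, y ∈ E k ∧ R.rel x y ∧ e y < e x}
  let M : ι × ℕ → Set X := fun k =>
    (V k \ ⋃ (k') (_ : f k' < f k), S k') ∩ ((P k)ᶜ ∪ (E k \ N k))
  have hVs : ∀ k, IsSuslin (V k) := fun k =>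
    MeasurableSet.exists_real_fiber ((measurable_snd (hT k)).inter (Rf k.1).rel_meas)
  have hSs : ∀ k, IsSuslin (S k) := fun k =>
    MeasurableSet.exists_real_fiber ((measurable_snd (hT k)).inter R.rel_meas)
  have hPs : ∀ k, IsSuslin (P k) := fun k =>
    IsSuslin.exists (((hVs k).preimage measurable_snd).inter
      (R.rel_meas.inter (Rf k.1).rel_meas.compl).isSuslin)
  have hEs : ∀ k, IsSuslin (E k) := by
    intro k
    have hp : IsSuslin {q : X × X | ∃ a b, a ≠ k.1 ∧ b ≠ k.1 ∧ ReducedPath Rf a b q.1 q.2} := by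
      have : IsSuslin (⋃ (a) (b), {q : X × X | a ≠ k.1 ∧ b ≠ k.1} ∩
          {q : X × X | ReducedPath Rf a b q.1 q.2}) :=
        IsSuslin.iUnion fun a => IsSuslin.iUnion fun b =>
          (MeasurableSet.const _).isSuslin.inter (ReducedPath.isSuslin Rf a b)
      convert this using 1
      ext q
      simp only [mem_iUnion, mem_inter_iff, mem_ofPred_eq, and_assoc]
    exact (hVs k).inter (IsSuslin.exists (((hVs k).preimage measurable_snd).inter hp))
  have hNs : ∀ k, IsSuslin (N k) := fun k =>
    IsSuslin.exists (((hEs k).preimage measurable_snd).inter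
      (R.rel_meas.inter (measurableSet_lt (he.measurable.comp measurable_snd)
        (he.measurable.comp measurable_fst))).isSuslin)
  have hMn : ∀ k, NullMeasurableSet (M k) μ := fun k =>
    (((hVs k).nullMeasurableSet μ).diff (.iUnion fun k' => .iUnion fun _ =>
      (hSs k').nullMeasurableSet μ)).inter (((hPs k).nullMeasurableSet μ).compl.union
        (((hEs k).nullMeasurableSet μ).diff ((hNs k).nullMeasurableSet μ)))
  have hVS : ∀ k, V k ⊆ S k := fun k x ⟨y, hy, hxy⟩ => ⟨y, hy, hfp.rel_of_rel hxy⟩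
  have hSR : ∀ k x y, R.rel x y → x ∈ S k → y ∈ S k := fun k x y hxy ⟨z, hz, hxz⟩ =>
    ⟨z, hz, R.trans (R.symm hxy) hxz⟩
  have huniq : ∀ k k' x y, x ∈ M k → y ∈ M k' → R.rel x y → k = k' := by
    intro k k' x y hx hy hxy
    by_contra hne
    rcases lt_or_gt_of_ne (fun h => hne (hf h)) with hlt | hlt
    · exact hy.1.2 (mem_iUnion₂.2 ⟨k, hlt, hSR k x y hxy (hVS k hx.1.1)⟩)
    · exact hx.1.2 (mem_iUnion₂.2 ⟨k', hlt, hSR k' y x (R.symm hxy) (hVS k' hy.1.1)⟩)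
  have hVd : ∀ k, V k ⊆ (Rf k.1).dom := fun k x ⟨y, _, hxy⟩ => ((Rf k.1).rel_dom hxy).1
  have hrel : ∀ k x y, x ∈ M k → y ∈ M k → R.rel x y → (Rf k.1).rel x y := by
    intro k x y hx hy hxy
    by_contra hn
    have hPx : x ∈ P k := ⟨y, hy.1.1, hxy, hn⟩
    have hPy : y ∈ P k := ⟨x, hx.1.1, R.symm hxy, fun h => hn ((Rf k.1).symm h)⟩
    have hEx := hx.2.resolve_left fun h => h hPx
    have hEy := hy.2.resolve_left fun h => h hPy
    rcases lt_trichotomy (e x) (e y) with hlt | heq | hlt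
    · exact hEy.2 ⟨x, hEx.1, R.symm hxy, hlt⟩
    · exact hn (he.injective heq ▸ (Rf k.1).refl x (hVd k hx.1.1))
    · exact hEx.2 ⟨y, hEy.1, hxy, hlt⟩
  have hexists : ∀ x, (∃ k, ∃ y ∈ T k, R.rel x y) →
      (∀ k, ¬ ∃ y : Fin (k.2 + 2) → X, (∀ j, R.rel x (y j) ∧ y j ∈ T k) ∧
        Pairwise fun j l => ¬ (Rf k.1).rel (y j) (y l)) → ∃ k, ∃ w ∈ M k, R.rel x w := by
    rintro x hxA hxB
    obtain ⟨k, hk, hmin⟩ : ∃ k, x ∈ S k ∧ ∀ k', f k' < f k → x ∉ S k' := by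
      obtain ⟨k, hk, hmin⟩ := (InvImage.wf f Nat.lt_wfRel.wf).has_min {k | x ∈ S k} hxA
      exact ⟨k, hk, fun k' hlt hk' => hmin k' hk' hlt⟩
    have hmin' : ∀ y, R.rel x y → y ∉ ⋃ (k') (_ : f k' < f k), S k' := by
      intro y hxy hy
      obtain ⟨k', hlt, hy⟩ := mem_iUnion₂.1 hy
      exact hmin k' hlt (hSR k' y x (R.symm hxy) hy)
    refine ⟨k, ?_⟩
    obtain ⟨y₀, hy₀, hxy₀⟩ := hk
    have hy₀V : y₀ ∈ V k := ⟨y₀, hy₀, (Rf k.1).refl y₀ (hTd k hy₀)⟩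
    by_cases hP : y₀ ∈ P k
    · obtain ⟨y₁, hy₁, hr, hn⟩ := hP
      obtain ⟨a, b, hp⟩ := (ReducedPath.of_eqvGen ((hfp.2.2 y₀ y₁).1 hr).2).resolve_left
        fun h => hn (h ▸ (Rf k.1).refl y₀ (hTd k hy₀))
      obtain ⟨v, w, a', b', hv, hw, ha', hb', hp'⟩ :=
        hp.exists_exit (hVd k hy₀V) (hVd k hy₁) hn
      have hVi : ∀ u u', (Rf k.1).rel u u' → u ∈ V k → u' ∈ V k := fun u u' huu' ⟨t, ht, hut⟩ =>
        ⟨t, ht, (Rf k.1).trans ((Rf k.1).symm huu') hut⟩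
      have hfin := hfp.finite_exits (hTd k) (hxB k)
      obtain ⟨u, hu, humin⟩ := Set.exists_min_image _ e hfin
        ⟨v, R.trans hxy₀ (hfp.rel_of_rel hv), hVi _ _ hv hy₀V, w, hVi _ _ hw hy₁,
          a', b', ha', hb', hp'⟩
      refine ⟨u, ⟨⟨hu.2.1, hmin' u hu.1⟩, Or.inr ⟨hu.2, ?_⟩⟩, hu.1⟩
      rintro ⟨u', hu', hr', hlt⟩
      exact hlt.not_ge (humin u' ⟨R.trans hu.1 hr', hu'⟩)
    · exact ⟨y₀, ⟨⟨hy₀V, hmin' y₀ hxy₀⟩, Or.inl hP⟩, hxy₀⟩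
  choose U hUM hUm hUe using fun k => (hMn k).exists_measurable_subset_ae_eq
  have hnull : μ (R.sat (⋃ k, M k \ U k)) = 0 :=
    hR.measure_sat_eq_zero (measure_iUnion_null fun k => (ae_le_set.1 (hUe k).symm.le))
  have hC : ∀ᵐ x ∂μ, ∃ k, ∃ w ∈ U k, R.rel x w := by
    filter_upwards [hA, hB, measure_eq_zero_iff_ae_notMem.1 hnull] with x hxA hxB hx
    obtain ⟨k, w, hw, hxw⟩ := hexists x hxA hxB
    refine ⟨k, w, ?_, hxw⟩
    by_contra hn
    exact hx ⟨w, mem_iUnion.2 ⟨k, hw, hn⟩, R.symm hxw⟩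
  obtain ⟨D, hCD, hDm, hD0⟩ := exists_measurable_superset_of_null hC
  refine ⟨fun i => ⋃ m, U (i, m), Dᶜ, fun i => .iUnion fun m => hUm _,
    fun i => hdom ▸ subset_univ _, ?_, hDm.compl, by rwa [compl_compl], ?_, ?_, ?_⟩
  · intro i j hij
    refine Set.disjoint_left.2 fun x hx hy => hij ?_
    obtain ⟨m, hm⟩ := mem_iUnion.1 hx
    obtain ⟨n, hn⟩ := mem_iUnion.1 hy
    exact congrArg Prod.fst (huniq _ _ x x (hUM _ hm) (hUM _ hn) (R.refl x (hdom ▸ mem_univ x)))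
  · rintro x ⟨-, hx⟩
    obtain ⟨k, w, hw, hxw⟩ := not_not.1 fun h => hx (hCD h)
    exact ⟨w, mem_iUnion₂.2 ⟨k.1, k.2, hw⟩, hxw⟩
  · rintro i j x ⟨hx, -⟩ y ⟨hy, -⟩ hxy
    obtain ⟨m, hm⟩ := mem_iUnion.1 hx
    obtain ⟨n, hn⟩ := mem_iUnion.1 hy
    exact congrArg Prod.fst (huniq _ _ x y (hUM _ hm) (hUM _ hn) hxy)
  · rintro i x ⟨hx, -⟩ y ⟨hy, -⟩
    refine ⟨fun hxy => ?_, hfp.rel_of_rel⟩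
    obtain ⟨m, hm⟩ := mem_iUnion.1 hx
    obtain ⟨n, hn⟩ := mem_iUnion.1 hy
    have h := huniq _ _ x y (hUM _ hm) (hUM _ hn) hxy
    exact hrel (i, m) x y (hUM _ hm) (h ▸ hUM _ hn) hxy

end

section
variable {X' X ι : Type} [MeasurableSpace X'] [MeasurableSpace X]

/-- The pullback to `R'` of a relation `S` along `p`, over an `R'`-invariant Borel set `Z`. Outside
of `Z` it is `R'` if `c` holds, and empty otherwise. -/
def CBER.pullback (R' : CBER X') (S : CBER X) {p : X' → X} (hp : Measurable p) {Z : Set X'}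
    (hZ : MeasurableSet Z) (hinv : ∀ x y, R'.rel x y → x ∈ Z → y ∈ Z) (c : Prop) : CBER X' where
  dom := R'.dom ∩ {x | (x ∈ Z ∧ p x ∈ S.dom) ∨ (x ∉ Z ∧ c)}
  dom_meas := R'.dom_meas.inter ((hZ.inter (hp S.dom_meas)).union (hZ.compl.inter (.const c)))
  rel x y := R'.rel x y ∧ ((x ∈ Z ∧ S.rel (p x) (p y)) ∨ (x ∉ Z ∧ c))
  rel_meas := R'.rel_meas.inter (((measurable_fst hZ).inter
    (measurableSet_preimage ((hp.comp measurable_fst).prodMk (hp.comp measurable_snd))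
      S.rel_meas)).union ((measurable_fst hZ).compl.inter (.const c)))
  rel_dom := by
    rintro x y ⟨hxy, ⟨hx, h⟩ | ⟨hx, hc⟩⟩
    · exact ⟨⟨(R'.rel_dom hxy).1, .inl ⟨hx, (S.rel_dom h).1⟩⟩,
        ⟨(R'.rel_dom hxy).2, .inl ⟨hinv x y hxy hx, (S.rel_dom h).2⟩⟩⟩
    · exact ⟨⟨(R'.rel_dom hxy).1, .inr ⟨hx, hc⟩⟩,
        ⟨(R'.rel_dom hxy).2, .inr ⟨fun hy => hx (hinv y x (R'.symm hxy) hy), hc⟩⟩⟩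
  refl := by
    rintro x ⟨hx, ⟨hxZ, h⟩ | h⟩
    · exact ⟨R'.refl x hx, .inl ⟨hxZ, S.refl _ h⟩⟩
    · exact ⟨R'.refl x hx, .inr h⟩
  symm := by
    rintro x y ⟨hxy, ⟨hx, h⟩ | ⟨hx, hc⟩⟩
    · exact ⟨R'.symm hxy, .inl ⟨hinv x y hxy hx, S.symm h⟩⟩
    · exact ⟨R'.symm hxy, .inr ⟨fun hy => hx (hinv y x (R'.symm hxy) hy), hc⟩⟩
  trans := by
    rintro x y z ⟨hxy, h⟩ ⟨hyz, h'⟩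
    refine ⟨R'.trans hxy hyz, ?_⟩
    rcases h with ⟨hx, h⟩ | h
    · rcases h' with ⟨-, h'⟩ | ⟨hy, -⟩
      · exact .inl ⟨hx, S.trans h h'⟩
      · exact absurd (hinv x y hxy hx) hy
    · exact .inr h
  countable_classes x := (R'.countable_classes x).mono fun _ h => h.1

/-- A free product decomposition pulls back along a locally bijective morphism. -/
theorem IsFreeProduct.pullback {R' : CBER X'} {R : CBER X} {Rf : ι → CBER X}
    (h : IsFreeProduct R Rf) (hdom' : R'.dom = univ) (hdom : R.dom = univ) {p : X' → X}
    (hp : Measurable p) {Z : Set X'} (hZ : MeasurableSet Z)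
    (hinv : ∀ x y, R'.rel x y → x ∈ Z → y ∈ Z)
    (hbij : ∀ x ∈ Z, BijOn p {y | R'.rel x y} {y | R.rel (p x) y}) (i₀ : ι) :
    IsFreeProduct R' fun i => R'.pullback (Rf i) hp hZ hinv (i = i₀) := by
  have hrefl : ∀ x, R'.rel x x := fun x => R'.refl x (hdom' ▸ mem_univ x)
  refine ⟨?_, ?_, ?_⟩
  · intro n x i hn hx hne hrel
    by_cases h0 : x 0 ∈ Z
    · have hmem : ∀ j ≤ n, x j ∈ Z := by
        intro j
        induction j with
        | zero => exact fun _ => h0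
        | succ j ih => exact fun hj => hinv _ _ (hrel j hj).1 (ih (by omega))
      refine h.1 n (fun j => p (x j)) i hn (congrArg p hx) (fun j hj hpj => hne j hj ?_) ?_
      · exact (hbij _ (hmem j hj.le)).injOn (hrefl _) (hrel j hj).1 hpj
      · intro j hj
        exact ((hrel j hj).2.resolve_right fun hn => hn.1 (hmem j hj.le)).2
    · refine ⟨0, hn, ?_⟩
      have h1 : x 1 ∉ Z := fun h1 => h0 (hinv _ _ (R'.symm (hrel 0 (by omega)).1) h1)
      exact ((hrel 0 (by omega)).2.resolve_left fun hn => h0 hn.1).2.trans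
        ((hrel 1 hn).2.resolve_left fun hn => h1 hn.1).2.symm
  · rw [hdom', eq_comm, eq_univ_iff_forall]
    intro x
    by_cases hx : x ∈ Z
    · have hpx : p x ∈ ⋃ i, (Rf i).dom := by
        rw [← h.2.1, hdom]
        exact mem_univ _
      obtain ⟨i, hi⟩ := mem_iUnion.1 hpx
      exact mem_iUnion.2 ⟨i, hdom' ▸ mem_univ x, .inl ⟨hx, hi⟩⟩
    · exact mem_iUnion.2 ⟨i₀, hdom' ▸ mem_univ x, .inr ⟨hx, rfl⟩⟩
  · intro x y
    refine ⟨fun hxy => ⟨hdom' ▸ mem_univ x, ?_⟩, fun hxy => ?_⟩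
    · by_cases hx : x ∈ Z
      · have hy := hinv x y hxy hx
        have hgen := ((h.2.2 (p x) (p y)).1 ((hbij x hx).mapsTo hxy)).2
        have hsymm : Std.Symm (fun u v => ∃ i, (Rf i).rel u v) :=
          ⟨fun _ _ ⟨i, hi⟩ => ⟨i, (Rf i).symm hi⟩⟩
        rw [Relation.EqvGen.eqvGen_eq_reflTransGen] at hgen
        generalize hu : p x = u at hgen
        induction hgen using Relation.ReflTransGen.head_induction_on generalizing x with
        | refl =>
          rw [(hbij x hx).injOn (hrefl x) hxy hu]
          exact .refl _
        | head hr _ ih =>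
          obtain ⟨i, hi⟩ := hr
          subst hu
          obtain ⟨w, hw, rfl⟩ := (hbij x hx).surjOn (h.rel_of_rel hi)
          exact .trans _ _ _ (.rel _ _ ⟨i, hw, .inl ⟨hx, hi⟩⟩)
            (ih w (R'.trans (R'.symm hw) hxy) (hinv x w hw hx) rfl)
      · exact .rel _ _ ⟨i₀, hxy, .inr ⟨hx, rfl⟩⟩
    · obtain ⟨-, hxy⟩ := hxy
      induction hxy with
      | rel _ _ h => exact h.choose_spec.1
      | refl x => exact hrefl x
      | symm _ _ _ ih => exact R'.symm ih
      | trans _ _ _ _ _ ih ih' => exact R'.trans ih ih'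

section density
variable {μ' : Measure X'} [IsFiniteMeasure μ'] {R' : CBER X'} {p : X' → X} {Z : Set X'}
  {R : CBER X}

/-- The density, with respect to the push-forward of `μ'`, of the push-forward of the restriction
of `μ'` to `U`. -/
noncomputable def fiberDensity (μ' : Measure X') (p : X' → X) (U : Set X') : X → ℝ≥0∞ :=
  ((μ'.restrict U).map p).rnDeriv (μ'.map p)

theorem measurable_fiberDensity (μ' : Measure X') (p : X' → X) (U : Set X') :
    Measurable (fiberDensity μ' p U) :=
  Measure.measurable_rnDeriv _ _

theorem setLIntegral_fiberDensity (hp : Measurable p) (U : Set X') {s : Set X}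
    (hs : MeasurableSet s) :
    ∫⁻ x in s, fiberDensity μ' p U x ∂(μ'.map p) = μ' (p ⁻¹' s ∩ U) := by
  have : ((μ'.restrict U).map p) ≪ μ'.map p :=
    (Measure.absolutelyContinuous_of_le Measure.restrict_le_self).map hp
  rw [fiberDensity, Measure.setLIntegral_rnDeriv this, Measure.map_apply hp hs,
    Measure.restrict_apply (hp hs)]

variable [StandardBorelSpace X]

/-- Finitely many countable-to-one Borel maps are simultaneously injective on a non-null subset of
any non-null set. -/
theorem exists_injOn_finset (ν : Measure X) [IsFiniteMeasure ν] {κ : Type*}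
    {A : Set X} (hA : MeasurableSet A) (hpos : ν A ≠ 0) {s : κ → X → X}
    (hs : ∀ j, Measurable (s j)) (hc : ∀ j y, {x | x ∈ A ∧ s j x = y}.Countable)
    (J : Finset κ) :
    ∃ A' ⊆ A, MeasurableSet A' ∧ ν A' ≠ 0 ∧ ∀ j ∈ J, InjOn (s j) A' := by
  classical
  induction J using Finset.induction_on with
  | empty => exact ⟨A, Subset.rfl, hA, hpos, by simp⟩
  | insert j J _ ih =>
    obtain ⟨A₁, hA₁, hA₁m, hA₁pos, h₁⟩ := ih
    obtain ⟨A₂, hA₂, hA₂m, hA₂pos, h₂⟩ := exists_injOn_of_countable_fibers ν hA₁m hA₁pos (hs j)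
      fun y => (hc j y).mono fun x (hx : x ∈ A₁ ∧ s j x = y) =>
        (⟨hA₁ hx.1, hx.2⟩ : x ∈ A ∧ s j x = y)
    refine ⟨A₂, hA₂.trans hA₁, hA₂m, hA₂pos, fun l hl => ?_⟩
    rcases Finset.mem_insert.1 hl with rfl | hl
    · exact h₂
    · exact (h₁ l hl).mono hA₂

/-- If the relation `R'` restricted to `U` projects into `S`, then in almost every `R`-class the set
where the fiber density of `U` is at least `1 / (m + 1)` meets at most `m + 1` classes of `S`. -/
theorem CBER.IsPMP.ae_not_many_classes [StandardBorelSpace X'] (hR' : R'.IsPMP μ')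
    (hp : Measurable p) (hZ : MeasurableSet Z) (hZ0 : μ' Zᶜ = 0)
    (hinv : ∀ x y, R'.rel x y → x ∈ Z → y ∈ Z)
    (hbij : ∀ x ∈ Z, BijOn p {y | R'.rel x y} {y | R.rel (p x) y})
    {S : CBER X} {U : Set X'} (hU : MeasurableSet U)
    (hUS : ∀ z ∈ U ∩ Z, ∀ w ∈ U ∩ Z, R'.rel z w → S.rel (p z) (p w)) (m : ℕ) :
    ∀ᵐ x ∂(μ'.map p), ¬ ∃ y : Fin (m + 2) → X,
      (∀ j, R.rel x (y j) ∧ ((m : ℝ≥0∞) + 1)⁻¹ ≤ fiberDensity μ' p U (y j)) ∧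
      Pairwise fun j l => ¬ S.rel (y j) (y l) := by
  set ν := μ'.map p
  set T := {x | ((m : ℝ≥0∞) + 1)⁻¹ ≤ fiberDensity μ' p U x}
  have hTm : MeasurableSet T := measurableSet_le measurable_const (measurable_fiberDensity μ' p U)
  have hBm : MeasurableSet {q : X × (Fin (m + 2) → X) | (∀ j, R.rel q.1 (q.2 j) ∧ q.2 j ∈ T) ∧
      Pairwise fun j l => ¬ S.rel (q.2 j) (q.2 l)} := by
    have h1 : ∀ j, MeasurableSet {q : X × (Fin (m + 2) → X) | R.rel q.1 (q.2 j) ∧ q.2 j ∈ T} :=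
      fun j => (measurableSet_preimage (f := fun q : X × (Fin (m + 2) → X) => (q.1, q.2 j))
        (by fun_prop) R.rel_meas).inter (measurableSet_preimage
          (f := fun q : X × (Fin (m + 2) → X) => q.2 j) (by fun_prop) hTm)
    have h2 : ∀ j l, MeasurableSet {q : X × (Fin (m + 2) → X) | S.rel (q.2 j) (q.2 l)} :=
      fun j l => measurableSet_preimage (f := fun q : X × (Fin (m + 2) → X) => (q.2 j, q.2 l))
        (by fun_prop) S.rel_meas
    convert (MeasurableSet.iInter h1).inter (MeasurableSet.iInter fun j => .iInter fun l =>
      .iInter fun _ : j ≠ l => (h2 j l).compl) using 1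
    ext q
    simp only [mem_inter_iff, mem_iInter, mem_ofPred_eq, mem_compl_iff, Pairwise]
  by_contra hcon
  rw [ae_iff] at hcon
  simp only [not_not] at hcon
  obtain ⟨A₀, s, hA₀m, hA₀pos, hs, hsB⟩ := exists_measurable_selection ν hBm hcon
  have hsj : ∀ j, Measurable fun x => s x j := fun j => (measurable_pi_apply j).comp hs
  obtain ⟨A, hAA₀, hAm, hApos, hinj⟩ := exists_injOn_finset ν hA₀m hA₀pos
    (s := fun j x => s x j) hsj (fun j y => (R.countable_classes y).mono fun x hx =>
      hx.2 ▸ R.symm ((hsB x hx.1).1 j).1) Finset.univ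
  replace hinj : ∀ j, InjOn (fun x => s x j) A := fun j => hinj j (Finset.mem_univ j)
  have hsA : ∀ x ∈ A, ∀ j, R.rel x (s x j) ∧ s x j ∈ T := fun x hx => (hsB x (hAA₀ hx)).1
  have himgm : ∀ j, MeasurableSet ((fun x => s x j) '' A) := fun j =>
    hAm.image_of_measurable_injOn (hsj j) (hinj j)
  let G : Fin (m + 2) → Set (X' × X') := fun j =>
    {q | R'.rel q.1 q.2 ∧ q.1 ∈ Z ∧ p q.1 ∈ A ∧ p q.2 = s (p q.1) j}
  have hGm : ∀ j, MeasurableSet (G j) := fun j =>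
    R'.rel_meas.inter ((measurable_fst hZ).inter (((hp.comp measurable_fst) hAm).inter
      (measurableSet_eq_fun (hp.comp measurable_snd)
        ((hsj j).comp (hp.comp measurable_fst)))))
  have hG1 : ∀ j, InjOn Prod.fst (G j) := by
    rintro j ⟨z, w⟩ ⟨hzw, hz, -, hpw⟩ ⟨z', w'⟩ ⟨hzw', -, -, hpw'⟩ h
    obtain rfl : z = z' := h
    exact Prod.ext rfl ((hbij z hz).injOn hzw hzw' (hpw.trans hpw'.symm))
  have hG2 : ∀ j, InjOn Prod.snd (G j) := by
    rintro j ⟨z, w⟩ ⟨hzw, hz, hzA, hpw⟩ ⟨z', w'⟩ ⟨hzw', -, hzA', hpw'⟩ h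
    obtain rfl : w = w' := h
    exact Prod.ext ((hbij w (hinv z w hzw hz)).injOn (R'.symm hzw) (R'.symm hzw')
      (hinj j hzA hzA' (hpw.symm.trans hpw'))) rfl
  have hfst : ∀ j, Prod.fst '' G j = p ⁻¹' A ∩ Z := by
    intro j
    ext z
    constructor
    · rintro ⟨⟨z, w⟩, ⟨-, hz, hzA, -⟩, rfl⟩
      exact ⟨hzA, hz⟩
    · rintro ⟨hzA, hz⟩
      obtain ⟨w, hw, hpw⟩ := (hbij z hz).surjOn (hsA _ hzA j).1
      exact ⟨(z, w), ⟨hw, hz, hzA, hpw⟩, rfl⟩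
  have hsnd : ∀ j, Prod.snd '' G j = p ⁻¹' ((fun x => s x j) '' A) ∩ Z := by
    intro j
    ext w
    constructor
    · rintro ⟨⟨z, w⟩, ⟨hzw, hz, hzA, hpw⟩, rfl⟩
      exact ⟨⟨p z, hzA, hpw.symm⟩, hinv z w hzw hz⟩
    · rintro ⟨⟨a, ha, hpw⟩, hw⟩
      have har := (hsA a ha j).1
      change s a j = p w at hpw
      rw [hpw] at har
      obtain ⟨z, hz, rfl⟩ := (hbij w hw).surjOn (R.symm har)
      exact ⟨(z, w), ⟨R'.symm hz, hinv w z hz hw, ha, hpw.symm⟩, rfl⟩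
  have hZc : ∀ B : Set X', μ' (B ∩ Z) = μ' B := fun B =>
    measure_inter_conull hZ0
  have hνA : ∀ j, ν ((fun x => s x j) '' A) = ν A := by
    intro j
    have := hR'.measure_image_fst_eq (hGm j) (fun q hq => hq.1) (hG1 j) (hG2 j)
    rw [hfst, hsnd, hZc, hZc] at this
    rw [Measure.map_apply hp hAm, Measure.map_apply hp (himgm j), this]
  let H : Fin (m + 2) → Set (X' × X') := fun j => G j ∩ Prod.snd ⁻¹' U
  have hHm : ∀ j, MeasurableSet (H j) := fun j => (hGm j).inter (measurable_snd hU)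
  have hH1 : ∀ j, InjOn Prod.fst (H j) := fun j => (hG1 j).mono inter_subset_left
  have hHimg : ∀ j, MeasurableSet (Prod.fst '' H j) := fun j =>
    (hHm j).image_of_measurable_injOn measurable_fst (hH1 j)
  have hlow : ∀ j, ((m : ℝ≥0∞) + 1)⁻¹ * ν A ≤ μ' (Prod.fst '' H j) := by
    intro j
    have h1 := hR'.measure_image_fst_eq (hHm j) (fun q hq => hq.1.1) (hH1 j)
      ((hG2 j).mono inter_subset_left)
    rw [image_inter_preimage, hsnd, inter_right_comm, hZc,
      ← setLIntegral_fiberDensity hp U (himgm j)] at h1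
    rw [h1, ← hνA j, ← setLIntegral_const]
    refine setLIntegral_mono (measurable_fiberDensity μ' p U) ?_
    rintro _ ⟨a, ha, rfl⟩
    exact (hsA a ha j).2
  have hdisj : Pairwise (Function.onFun Disjoint fun j => Prod.fst '' H j) := by
    intro j l hjl
    refine Set.disjoint_left.2 ?_
    rintro _ ⟨⟨z, w⟩, ⟨⟨hzw, hz, hzA, hpw⟩, hw⟩, rfl⟩ ⟨⟨z', w'⟩, ⟨⟨hzw', -, -, hpw'⟩, hw'⟩, h⟩
    obtain rfl : z' = z := h
    refine (hsB _ (hAA₀ hzA)).2 hjl ?_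
    have := hUS w ⟨hw, hinv _ _ hzw hz⟩ w' ⟨hw', hinv _ _ hzw' hz⟩ (R'.trans (R'.symm hzw) hzw')
    change p w = _ at hpw
    change p w' = _ at hpw'
    rwa [hpw, hpw'] at this
  have hsum : ∑ _j : Fin (m + 2), ((m : ℝ≥0∞) + 1)⁻¹ * ν A ≤ ν A := by
    calc _ ≤ ∑ j, μ' (Prod.fst '' H j) := Finset.sum_le_sum fun j _ => hlow j
      _ = μ' (⋃ j, Prod.fst '' H j) := by
        rw [measure_iUnion hdisj hHimg, tsum_fintype]
      _ ≤ μ' (p ⁻¹' A) := measure_mono (iUnion_subset fun j => by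
          refine (image_mono inter_subset_left).trans ?_
          rw [hfst]
          exact inter_subset_left)
      _ = ν A := (Measure.map_apply hp hAm).symm
  rw [Finset.sum_const, Finset.card_univ, Fintype.card_fin, nsmul_eq_mul, ← mul_assoc] at hsum
  have hlt : 1 < ((m + 2 : ℕ) : ℝ≥0∞) * ((m : ℝ≥0∞) + 1)⁻¹ := by
    rw [← div_eq_mul_inv, ENNReal.lt_div_iff_mul_lt (by simp) (by simp), one_mul]
    exact_mod_cast Nat.lt_succ_self (m + 1)
  have := ENNReal.mul_lt_mul_left hApos (measure_ne_top ν A) hlt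
  rw [one_mul] at this
  exact this.not_ge hsum

/-- If the union of the sets `U i` meets every `R'`-class in `Z`, then almost every `R`-class
contains a point where one of the fiber densities is bounded below by some `1 / (m + 1)`. -/
theorem CBER.IsPMP.ae_exists_fiberDensity_ge [StandardBorelSpace X'] (hR' : R'.IsPMP μ')
    [Countable ι] {Rf : ι → CBER X} (hp : Measurable p)
    (hZ0 : μ' Zᶜ = 0) (hinv : ∀ x y, R'.rel x y → x ∈ Z → y ∈ Z)
    (hbij : ∀ x ∈ Z, BijOn p {y | R'.rel x y} {y | R.rel (p x) y})
    {U : ι → Set X'} (hUd : ∀ i, ∀ w ∈ U i ∩ Z, p w ∈ (Rf i).dom)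
    (hUc : ∀ x ∈ Z, ∃ i, ∃ w ∈ U i, R'.rel x w) :
    ∀ᵐ x ∂(μ'.map p), ∃ k : ι × ℕ, ∃ y, (((k.2 : ℝ≥0∞) + 1)⁻¹ ≤ fiberDensity μ' p (U k.1) y ∧
      y ∈ (Rf k.1).dom) ∧ R.rel x y := by
  have hT : ∀ k : ι × ℕ, MeasurableSet {y | ((k.2 : ℝ≥0∞) + 1)⁻¹ ≤ fiberDensity μ' p (U k.1) y ∧
      y ∈ (Rf k.1).dom} := fun k =>
    (measurableSet_le measurable_const (measurable_fiberDensity μ' p _)).inter (Rf k.1).dom_meas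
  have hSus : IsSuslin {x | ∃ k : ι × ℕ, ∃ y, (((k.2 : ℝ≥0∞) + 1)⁻¹ ≤ fiberDensity μ' p (U k.1) y ∧
      y ∈ (Rf k.1).dom) ∧ R.rel x y} := by
    rw [ofPred_exists]
    exact IsSuslin.iUnion fun k =>
      MeasurableSet.exists_real_fiber ((measurable_snd (hT k)).inter R.rel_meas)
  have hN : μ' (R'.sat (⋃ i, p ⁻¹' {x | fiberDensity μ' p (U i) x = 0} ∩ U i)) = 0 := by
    refine hR'.measure_sat_eq_zero (measure_iUnion_null fun i => ?_)
    have hm : MeasurableSet {x | fiberDensity μ' p (U i) x = 0} :=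
      measurable_fiberDensity μ' p (U i) (measurableSet_singleton 0)
    rw [← setLIntegral_fiberDensity hp _ hm, setLIntegral_congr_fun hm fun x hx => hx]
    simp
  rw [ae_iff]
  refine (Measure.map_apply₀ hp.aemeasurable (hSus.nullMeasurableSet _).compl).trans ?_
  refine measure_mono_null (fun z hz => ?_) (measure_union_null hZ0 hN)
  by_contra hcon
  rw [mem_union, not_or] at hcon
  obtain ⟨hzZ, hzN⟩ := hcon
  rw [mem_compl_iff, not_not] at hzZ
  obtain ⟨i, w, hw, hzw⟩ := hUc z hzZ
  have hne : fiberDensity μ' p (U i) (p w) ≠ 0 := fun h0 =>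
    hzN ⟨w, mem_iUnion.2 ⟨i, h0, hw⟩, R'.symm hzw⟩
  obtain ⟨m, hm⟩ := ENNReal.exists_inv_nat_lt hne
  exact hz ⟨(i, m), p w, ⟨(ENNReal.inv_le_inv.2 le_self_add).trans hm.le,
    hUd i w ⟨hw, hinv z w hzw hzZ⟩⟩, (hbij z hzZ).mapsTo hzw⟩

end density
end

/-- A locally bijective morphism `p : (X̃, R̃) → (X, R)` (with `p_*μ̃ ∼ μ`
and `p` a.e. bijective from `R̃`-classes onto `R`-classes) transports free
indecomposability downwards: if `R̃` is FI then `R` is FI. -/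
theorem FI_descends_along_locally_bijective_morphism
    {X' X : Type} [MeasurableSpace X'] [StandardBorelSpace X']
    [MeasurableSpace X] [StandardBorelSpace X]
    (μ' : MeasureTheory.Measure X') [MeasureTheory.IsProbabilityMeasure μ']
    (μ : MeasureTheory.Measure X) [MeasureTheory.IsProbabilityMeasure μ]
    (R' : CBER X') (R : CBER X)
    (hpmp' : R'.IsPMP μ') (hpmp : R.IsPMP μ)
    (hdom' : R'.dom = Set.univ) (hdom : R.dom = Set.univ)
    (p : X' → X) (hp : Measurable p)
    (habs : MeasureTheory.Measure.map p μ' ≪ μ)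
    (habs' : μ ≪ MeasureTheory.Measure.map p μ')
    (hloc : ∀ᵐ x' ∂μ', Set.BijOn p {y' | R'.rel x' y'} {y | R.rel (p x') y})
    (hFI : FreelyIndecomposableMod μ' R') :
    FreelyIndecomposableMod μ R := by
  intro ι hι Rf hfp
  have hrefl : ∀ x, R'.rel x x := fun x => R'.refl x (hdom' ▸ mem_univ x)
  obtain ⟨x₀⟩ : Nonempty X := nonempty_of_isProbabilityMeasure μ
  have hx₀ : x₀ ∈ ⋃ i, (Rf i).dom := by
    rw [← hfp.2.1, hdom]
    exact mem_univ _
  obtain ⟨i₀, -⟩ := mem_iUnion.1 hx₀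
  obtain ⟨Z₁, hZ₁, hZ₁m, hZ₁0, hinv₁⟩ := hpmp'.exists_invariant_conull_subset hloc
  obtain ⟨U, C, hUm, -, -, -, hC0, hUc, -, hUS⟩ :=
    hFI ι hι _ (hfp.pullback hdom' hdom hp hZ₁m hinv₁ (fun x hx => hZ₁ hx) i₀)
  obtain ⟨Z, hZsub, hZm, hZ0, hinv⟩ := hpmp'.exists_invariant_conull_subset (A := Z₁ ∩ C) (by
    rw [compl_inter]
    exact measure_union_null hZ₁0 hC0)
  have hbij : ∀ x ∈ Z, BijOn p {y | R'.rel x y} {y | R.rel (p x) y} := fun x hx =>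
    hZ₁ (hZsub hx).1
  have hUS' : ∀ i, ∀ z ∈ U i ∩ Z, ∀ w ∈ U i ∩ Z, R'.rel z w → (Rf i).rel (p z) (p w) := by
    intro i z hz w hw hzw
    have h := (hUS i z ⟨hz.1, (hZsub hz.2).2⟩ w ⟨hw.1, (hZsub hw.2).2⟩).1 hzw
    exact (h.2.resolve_right fun hn => hn.1 (hZsub hz.2).1).2
  refine IsFreeProduct.inessentialMod_of_finite_index hpmp hdom hfp
    (T := fun k => {y | ((k.2 : ℝ≥0∞) + 1)⁻¹ ≤ fiberDensity μ' p (U k.1) y ∧ y ∈ (Rf k.1).dom})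
    (fun k => (measurableSet_le measurable_const (measurable_fiberDensity μ' p _)).inter
      (Rf k.1).dom_meas) (fun k y hy => hy.2) (habs'.ae_le ?_) (habs'.ae_le ?_)
  · refine hpmp'.ae_exists_fiberDensity_ge hp hZ0 hinv hbij
      (fun i w hw => ((Rf i).rel_dom (hUS' i w hw w hw (hrefl w))).1) fun x hx => ?_
    obtain ⟨w, hw, hxw⟩ := hUc x ⟨hdom' ▸ mem_univ x, (hZsub hx).2⟩
    obtain ⟨i, hi⟩ := mem_iUnion.1 hw
    exact ⟨i, w, hi, hxw⟩
  · refine ae_all_iff.2 fun k => ?_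
    filter_upwards [hpmp'.ae_not_many_classes hp hZm hZ0 hinv hbij (hUm k.1) (hUS' k.1) k.2]
      with x hx
    rintro ⟨y, hy, hy'⟩
    exact hx ⟨y, fun j => ⟨(hy j).1, (hy j).2.1⟩, hy'⟩
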